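/- arXiv:1410.3502 — 7 statements merged into one kernel-verified Lean document; each statement's English description precedes it below -/
import Mathlib

section
/- Let f ∈ C²[0,1] and let μ₀ ∈ (0,1). Then there exists a natural number n₁ (depending on f and μ₀) such that for all n ≥ n₁, (μ₀/32)·ω²_φ(f, 1/√n) ≤ ‖f − B_n f‖ ≤ 3·ω²_φ(f, 1/√n). -/
open Real Set Filter

/-- `φ(x) = √(x(1-x))`. -/
noncomputable def phi (x : ℝ) : ℝ := Real.sqrt (x * (1 - x))

/-- The Bernstein operator `B_n(f;x) = ∑_{k=0}^n f(k/n) C(n,k) x^k (1-x)^{n-k}`. -/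
noncomputable def bern (n : ℕ) (f : ℝ → ℝ) (x : ℝ) : ℝ :=
  ∑ k ∈ Finset.range (n + 1),
    f ((k : ℝ) / (n : ℝ)) * (n.choose k : ℝ) * x ^ k * (1 - x) ^ (n - k)

/-- The sup norm on `[0,1]`. -/
noncomputable def supNorm (g : ℝ → ℝ) : ℝ := sSup ((fun x => |g x|) '' Set.Icc 0 1)

/-- The second order Ditzian–Totik modulus of smoothness. -/
noncomputable def omega2phi (f : ℝ → ℝ) (δ : ℝ) : ℝ :=
  sSup {y : ℝ | ∃ h ∈ Set.Icc (0 : ℝ) δ,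
    ∃ x ∈ Set.Icc (h ^ 2 / (1 + h ^ 2)) (1 / (1 + h ^ 2)),
      y = |f (x + h * phi x) - 2 * f x + f (x - h * phi x)|}

/-- The usual first modulus of continuity on `[0,1]`. -/
noncomputable def omega1 (g : ℝ → ℝ) (δ : ℝ) : ℝ :=
  sSup {y : ℝ | ∃ x ∈ Set.Icc (0 : ℝ) 1, ∃ z ∈ Set.Icc (0 : ℝ) 1,
    |x - z| ≤ δ ∧ y = |g x - g z|}

/-- The usual second modulus of smoothness on `[0,1]`. -/
noncomputable def omega2 (g : ℝ → ℝ) (δ : ℝ) : ℝ :=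
  sSup {y : ℝ | ∃ h : ℝ, 0 < h ∧ h ≤ δ ∧ ∃ x : ℝ, x ∈ Set.Icc (0 : ℝ) 1 ∧
    x + 2 * h ∈ Set.Icc (0 : ℝ) 1 ∧ y = |g (x + 2 * h) - 2 * g (x + h) + g x|}


/-- expectation against the binomial distribution -/
noncomputable def binE (n : ℕ) (x : ℝ) (g : ℝ → ℝ) : ℝ :=
  ∑ k ∈ Finset.range (n + 1), g (k : ℝ) * (n.choose k : ℝ) * x ^ k * (1 - x) ^ (n - k)

lemma binE_eq (n : ℕ) (x : ℝ) (g : ℝ → ℝ) :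
    binE n x g = ∑ ij ∈ Finset.HasAntidiagonal.antidiagonal n,
      (n.choose ij.1 : ℝ) * (g (ij.1 : ℝ) * x ^ ij.1 * (1 - x) ^ ij.2) := by
  rw [Finset.Nat.sum_antidiagonal_eq_sum_range_succ
    (fun i j => (n.choose i : ℝ) * (g (i : ℝ) * x ^ i * (1 - x) ^ j))]
  unfold binE
  refine Finset.sum_congr rfl fun k _ => ?_
  ring

lemma binE_succ (n : ℕ) (x : ℝ) (g : ℝ → ℝ) :
    binE (n + 1) x g = (1 - x) * binE n x g + x * binE n x (fun k => g (k + 1)) := by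
  rw [binE_eq, binE_eq, binE_eq,
    Finset.sum_antidiagonal_choose_succ_mul (fun i j => g (i : ℝ) * x ^ i * (1 - x) ^ j) n,
    Finset.mul_sum, Finset.mul_sum]
  congr 1
  · refine Finset.sum_congr rfl fun k _ => ?_
    ring
  · refine Finset.sum_congr rfl fun k hk => ?_
    rw [Finset.HasAntidiagonal.mem_antidiagonal] at hk
    rw [Nat.choose_symm_of_eq_add (show n = k.2 + k.1 by omega)]
    push_cast
    ring

lemma binE_add (n : ℕ) (x : ℝ) (g h : ℝ → ℝ) :
    binE n x (fun k => g k + h k) = binE n x g + binE n x h := by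
  unfold binE
  rw [← Finset.sum_add_distrib]
  refine Finset.sum_congr rfl fun k _ => ?_
  ring

lemma binE_smul (n : ℕ) (x c : ℝ) (g : ℝ → ℝ) :
    binE n x (fun k => c * g k) = c * binE n x g := by
  unfold binE
  rw [Finset.mul_sum]
  refine Finset.sum_congr rfl fun k _ => ?_
  ring

lemma binE_one (n : ℕ) (x : ℝ) : binE n x (fun _ => 1) = 1 := by
  induction n with
  | zero => simp [binE]
  | succ n ih => rw [binE_succ, ih]; ring

lemma binE_m1 (n : ℕ) (x : ℝ) : ∀ a : ℝ, binE n x (fun k => k - a) = n * x - a := by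
  induction n with
  | zero => simp [binE]
  | succ n ih =>
    intro a
    have := ih (a - 1)
    rw [binE_succ, ih a, show (fun k : ℝ => k + 1 - a) = (fun k => k - (a - 1)) by
      funext k; ring, this]
    push_cast; ring

lemma binE_m2 (n : ℕ) (x : ℝ) : ∀ a : ℝ, binE n x (fun k => (k - a) ^ 2) =
    n * (x * (1 - x)) + (n * x - a) ^ 2 := by
  induction n with
  | zero => simp [binE]
  | succ n ih =>
    intro a
    have := ih (a - 1)
    rw [binE_succ, ih a, show (fun k : ℝ => (k + 1 - a) ^ 2) = (fun k => (k - (a - 1)) ^ 2) by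
      funext k; ring, this]
    push_cast; ring

lemma binE_m4 (n : ℕ) (x : ℝ) : ∀ a : ℝ, binE n x (fun k => (k - a) ^ 4) =
    n * (x * (1 - x)) * (1 + 3 * (n - 2) * (x * (1 - x)))
      + 4 * (n * (x * (1 - x)) * (1 - 2 * x)) * (n * x - a)
      + 6 * (n * (x * (1 - x))) * (n * x - a) ^ 2 + (n * x - a) ^ 4 := by
  induction n with
  | zero => simp [binE]
  | succ n ih =>
    intro a
    have := ih (a - 1)
    rw [binE_succ, ih a, show (fun k : ℝ => (k + 1 - a) ^ 4) = (fun k => (k - (a - 1)) ^ 4) by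
      funext k; ring, this]
    push_cast; ring

lemma binE_abs_le (n : ℕ) (x : ℝ) (hx : x ∈ Icc (0 : ℝ) 1) (g h : ℝ → ℝ)
    (hgh : ∀ k : ℕ, k ≤ n → |g k| ≤ h k) : |binE n x g| ≤ binE n x h := by
  unfold binE
  refine (Finset.abs_sum_le_sum_abs _ _).trans (Finset.sum_le_sum fun k hk => ?_)
  have h1 : 0 ≤ 1 - x := by linarith [hx.2]
  have h0 := hx.1
  rw [mul_assoc, mul_assoc, abs_mul, abs_of_nonneg (a := (n.choose k : ℝ) * _) (by positivity),
    mul_assoc, mul_assoc]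
  exact mul_le_mul_of_nonneg_right (hgh k (by simpa [Nat.lt_succ_iff] using hk)) (by positivity)

/-- quantitative second order Taylor property -/
def TaylorH (f f1 f2 : ℝ → ℝ) (a b : ℝ) : Prop :=
  ∀ x ∈ Icc (0 : ℝ) 1, ∀ t ∈ Icc (0 : ℝ) 1,
    |f t - f x - f1 x * (t - x) - f2 x / 2 * (t - x) ^ 2| ≤ (t - x) ^ 2 * (a + b * (t - x) ^ 2)

lemma bern_est {f f1 f2 : ℝ → ℝ} {a b : ℝ} (hb : 0 ≤ b) (H : TaylorH f f1 f2 a b)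
    (n : ℕ) (hn : 0 < n) (x : ℝ) (hx : x ∈ Icc (0 : ℝ) 1) :
    |n * (bern n f x - f x) - x * (1 - x) * f2 x / 2| ≤ x * (1 - x) * (a + 2 * b / n) := by
  have hn' : (0 : ℝ) < n := by exact_mod_cast hn
  have hn1 : (1 : ℝ) ≤ n := by exact_mod_cast hn
  have h1 : 0 ≤ 1 - x := by linarith [hx.2]
  have h0 := hx.1
  have e1 : bern n f x = binE n x (fun k => f (k / n)) := rfl
  have key := binE_abs_le n x hx
    (fun k => f (k / n) + ((- f x) * 1 + ((- f1 x / n) * (k - n * x)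
      + (- f2 x / 2 / n ^ 2) * (k - n * x) ^ 2)))
    (fun k => (a / n ^ 2) * (k - n * x) ^ 2 + (b / n ^ 4) * (k - n * x) ^ 4) (by
      intro k hk
      have hk' : (k : ℝ) ≤ n := by exact_mod_cast hk
      have := H x hx (k / n) ⟨by positivity, by rw [div_le_one hn']; exact hk'⟩
      have e : (k : ℝ) / n - x = (k - n * x) / n := by field_simp
      rw [e] at this
      convert this using 1
      · congr 1; field_simp; ring
      · field_simp)
  rw [binE_add, binE_add, binE_add, binE_add, binE_smul, binE_smul, binE_smul, binE_smul,
    binE_smul, binE_one, binE_m1, binE_m2, binE_m4, ← e1] at key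
  have e2 : n * (bern n f x - f x) - x * (1 - x) * f2 x / 2 = n * (bern n f x + ((- f x) * 1 +
      ((- f1 x / n) * (n * x - n * x)
      + (- f2 x / 2 / n ^ 2) * (n * (x * (1 - x)) + (n * x - n * x) ^ 2)))) := by
    field_simp; ring
  rw [e2, abs_mul, abs_of_pos hn']
  refine (mul_le_mul_of_nonneg_left key hn'.le).trans ?_
  have hq : 0 ≤ x * (1 - x) := by positivity
  have hq4 : x * (1 - x) ≤ 1 / 4 := by nlinarith [sq_nonneg (x - 1 / 2)]
  generalize x * (1 - x) = q at *
  have e3 : (n : ℝ) * (a / n ^ 2 * (n * q + (n * x - n * x) ^ 2) + b / n ^ 4 *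
      (n * q * (1 + 3 * (n - 2) * q) + 4 * (n * q * (1 - 2 * x)) * (n * x - n * x) +
      6 * (n * q) * (n * x - n * x) ^ 2 + (n * x - n * x) ^ 4))
      = q * a + b * q / n ^ 2 * (1 + 3 * (n - 2) * q) := by
    field_simp; ring
  rw [e3]
  have e4 : (1 + 3 * ((n : ℝ) - 2) * q) ≤ 2 * n := by nlinarith
  have e5 : b * q / n ^ 2 * (1 + 3 * ((n : ℝ) - 2) * q) ≤ b * q / n ^ 2 * (2 * n) :=
    mul_le_mul_of_nonneg_left e4 (by positivity)
  have e6 : b * q / n ^ 2 * (2 * (n : ℝ)) = q * (2 * b / n) := by field_simp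
  linarith

lemma phi_sq {x : ℝ} (hx : x ∈ Icc (0 : ℝ) 1) : phi x ^ 2 = x * (1 - x) :=
  Real.sq_sqrt (mul_nonneg hx.1 (by linarith [hx.2]))

lemma range_mem {h x : ℝ} (hx : x ∈ Icc (h ^ 2 / (1 + h ^ 2)) (1 / (1 + h ^ 2))) :
    x ∈ Icc (0 : ℝ) 1 := by
  constructor
  · exact le_trans (by positivity) hx.1
  · refine hx.2.trans ?_
    rw [div_le_one (by positivity)]
    nlinarith [sq_nonneg h]

lemma step_mem {h x : ℝ} (h0 : 0 ≤ h) (hx : x ∈ Icc (h ^ 2 / (1 + h ^ 2)) (1 / (1 + h ^ 2))) :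
    x + h * phi x ∈ Icc (0 : ℝ) 1 ∧ x - h * phi x ∈ Icc (0 : ℝ) 1 := by
  have hI := range_mem hx
  have hp := phi_sq hI
  have hp0 : 0 ≤ phi x := Real.sqrt_nonneg _
  obtain ⟨a1, a2⟩ := hx
  rw [div_le_iff₀ (by positivity)] at a1
  rw [le_div_iff₀ (by positivity)] at a2
  have h1 : 0 ≤ 1 - x := by linarith [hI.2]
  have b1 : h * phi x ≤ x := by
    refine abs_le_of_sq_le_sq' ?_ hI.1 |>.2
    rw [mul_pow, hp]; nlinarith [hI.1]
  have b2 : h * phi x ≤ 1 - x := by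
    refine abs_le_of_sq_le_sq' ?_ h1 |>.2
    rw [mul_pow, hp]; nlinarith [hI.1]
  have b3 : 0 ≤ h * phi x := by positivity
  exact ⟨⟨by linarith [hI.1], by linarith⟩, ⟨by linarith, by linarith⟩⟩

lemma delta_est {f f1 f2 : ℝ → ℝ} {a b : ℝ} (hb : 0 ≤ b) (H : TaylorH f f1 f2 a b)
    {h x : ℝ} (h0 : 0 ≤ h) (hx : x ∈ Icc (h ^ 2 / (1 + h ^ 2)) (1 / (1 + h ^ 2))) :
    |f (x + h * phi x) - 2 * f x + f (x - h * phi x) - h ^ 2 * (x * (1 - x) * f2 x)|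
      ≤ h ^ 2 * (2 * (x * (1 - x)) * (a + b * h ^ 2)) := by
  have hI := range_mem hx
  obtain ⟨m1, m2⟩ := step_mem h0 hx
  have hp := phi_sq hI
  have t1 := H x hI _ m1
  have t2 := H x hI _ m2
  have h1 : 0 ≤ 1 - x := by linarith [hI.2]
  have hq : 0 ≤ x * (1 - x) := mul_nonneg hI.1 h1
  have hq4 : x * (1 - x) ≤ 1 := by nlinarith [sq_nonneg (x - 1 / 2)]
  have s1 : (x + h * phi x - x) ^ 2 = h ^ 2 * (x * (1 - x)) := by rw [← hp]; ring
  have s2 : (x - h * phi x - x) ^ 2 = h ^ 2 * (x * (1 - x)) := by rw [← hp]; ring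
  rw [s1] at t1
  rw [s2] at t2
  have t3 := (abs_add_le _ _).trans (add_le_add t1 t2)
  have hh : 0 ≤ h ^ 2 := sq_nonneg h
  calc _ = _ := by congr 1; ring
    _ ≤ _ := t3
    _ ≤ _ := by
      have : b * (h ^ 2 * (x * (1 - x))) ≤ b * h ^ 2 :=
        mul_le_mul_of_nonneg_left (by nlinarith) hb
      have h3 : 0 ≤ h ^ 2 * (x * (1 - x)) := by positivity
      nlinarith

lemma taylor_basic {f f1 f2 : ℝ → ℝ}
    (hd1 : ∀ x ∈ Icc (0 : ℝ) 1, HasDerivWithinAt f (f1 x) (Icc 0 1) x)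
    (hd2 : ∀ x ∈ Icc (0 : ℝ) 1, HasDerivWithinAt f1 (f2 x) (Icc 0 1) x)
    {x t η : ℝ} (hx : x ∈ Icc (0 : ℝ) 1) (ht : t ∈ Icc (0 : ℝ) 1)
    (hη : ∀ ξ ∈ uIcc x t, |f2 ξ - f2 x| ≤ η) :
    |f t - f x - f1 x * (t - x) - f2 x / 2 * (t - x) ^ 2| ≤ (t - x) ^ 2 * η := by
  have hsub : uIcc x t ⊆ Icc (0 : ℝ) 1 := by
    exact uIcc_subset_Icc hx ht
  have hη0 : 0 ≤ η := (abs_nonneg _).trans (hη x left_mem_uIcc)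
  have step1 : ∀ ξ ∈ uIcc x t, |f1 ξ - f1 x - f2 x * (ξ - x)| ≤ η * |t - x| := by
    intro ξ hξ
    have := (convex_uIcc x t).norm_image_sub_le_of_norm_hasDerivWithin_le
      (f := fun y => f1 y - f2 x * (y - x)) (f' := fun y => f2 y - f2 x * 1) (C := η)
      (fun y hy => ((hd2 y (hsub hy)).mono hsub).sub
        (((hasDerivWithinAt_id y _).sub_const x).const_mul (f2 x)))
      (fun y hy => by simpa using hη y hy) left_mem_uIcc hξ
    simp only [Real.norm_eq_abs] at this
    have e : f1 ξ - f2 x * (ξ - x) - (f1 x - f2 x * (x - x)) = f1 ξ - f1 x - f2 x * (ξ - x) := by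
      ring
    rw [e] at this
    exact this.trans (mul_le_mul_of_nonneg_left (abs_sub_left_of_mem_uIcc hξ) hη0)
  have := (convex_uIcc x t).norm_image_sub_le_of_norm_hasDerivWithin_le
      (f := fun y => f y - f1 x * (y - x) - f2 x / 2 * (y - x) ^ 2)
      (f' := fun y => f1 y - f1 x - f2 x * (y - x)) (C := η * |t - x|)
      (fun y hy => by
        have a1 := ((hasDerivWithinAt_id y (uIcc x t)).sub_const x).const_mul (f1 x)
        have a2 := (((hasDerivWithinAt_id y (uIcc x t)).sub_const x).pow 2).const_mul (f2 x / 2)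
        refine ((((hd1 y (hsub hy)).mono hsub).sub a1).sub a2).congr_deriv ?_
        simp; ring)
      (fun y hy => step1 y hy) left_mem_uIcc right_mem_uIcc
  simp only [Real.norm_eq_abs] at this
  calc _ = _ := by congr 1; ring
    _ ≤ _ := this
    _ = _ := by rw [mul_assoc, ← sq, sq_abs]; ring

lemma exists_taylor {f f1 f2 : ℝ → ℝ}
    (hd1 : ∀ x ∈ Icc (0 : ℝ) 1, HasDerivWithinAt f (f1 x) (Icc 0 1) x)
    (hd2 : ∀ x ∈ Icc (0 : ℝ) 1, HasDerivWithinAt f1 (f2 x) (Icc 0 1) x)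
    (hc : ContinuousOn f2 (Icc 0 1)) {ε : ℝ} (hε : 0 < ε) :
    ∃ b, 0 ≤ b ∧ TaylorH f f1 f2 ε b := by
  obtain ⟨K, hK⟩ := isCompact_Icc.exists_bound_of_continuousOn hc
  have huc := isCompact_Icc.uniformContinuousOn_of_continuous hc
  rw [Metric.uniformContinuousOn_iff] at huc
  obtain ⟨δ, hδ, hu⟩ := huc ε hε
  have hK0 : 0 ≤ K := (norm_nonneg _).trans (hK 0 (by simp))
  refine ⟨2 * K / δ ^ 2, by positivity, fun x hx t ht => taylor_basic hd1 hd2 hx ht ?_⟩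
  intro ξ hξ
  have hsub : uIcc x t ⊆ Icc (0 : ℝ) 1 := by
    exact uIcc_subset_Icc hx ht
  by_cases hlt : |t - x| < δ
  · have := hu ξ (hsub hξ) x hx (by
      rw [Real.dist_eq]; exact (abs_sub_left_of_mem_uIcc hξ).trans_lt hlt)
    rw [Real.dist_eq] at this
    have : 0 ≤ 2 * K / δ ^ 2 * (t - x) ^ 2 := by positivity
    linarith
  · push Not at hlt
    have h1 := hK ξ (hsub hξ)
    have h2 := hK x hx
    rw [Real.norm_eq_abs] at h1 h2
    have h3 := abs_sub (f2 ξ) (f2 x)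
    have h4 : δ ^ 2 ≤ (t - x) ^ 2 := by rw [← sq_abs (t - x)]; gcongr
    have h5 : 2 * K ≤ 2 * K / δ ^ 2 * (t - x) ^ 2 := by
      rw [div_mul_eq_mul_div, le_div_iff₀ (by positivity)]
      exact mul_le_mul_of_nonneg_left h4 (by positivity)
    linarith

/-- Sup bounds -/
lemma supNorm_le {g : ℝ → ℝ} {C : ℝ} (h : ∀ x ∈ Icc (0 : ℝ) 1, |g x| ≤ C) : supNorm g ≤ C := by
  unfold supNorm
  refine csSup_le (Set.Nonempty.image _ ⟨0, by simp⟩) ?_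
  rintro _ ⟨x, hx, rfl⟩
  exact h x hx

lemma le_supNorm {g : ℝ → ℝ} {C : ℝ} (h : ∀ x ∈ Icc (0 : ℝ) 1, |g x| ≤ C) {x : ℝ}
    (hx : x ∈ Icc (0 : ℝ) 1) : |g x| ≤ supNorm g := by
  unfold supNorm
  refine le_csSup ⟨C, ?_⟩ ⟨x, hx, rfl⟩
  rintro _ ⟨x, hx, rfl⟩
  exact h x hx

lemma omega_le {f : ℝ → ℝ} {δ C : ℝ} (hδ : 0 ≤ δ)
    (h : ∀ h ∈ Icc (0 : ℝ) δ, ∀ x ∈ Icc (h ^ 2 / (1 + h ^ 2)) (1 / (1 + h ^ 2)),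
      |f (x + h * phi x) - 2 * f x + f (x - h * phi x)| ≤ C) : omega2phi f δ ≤ C := by
  unfold omega2phi
  refine csSup_le ⟨_, 0, ⟨le_rfl, hδ⟩, 0, by simp, rfl⟩ ?_
  rintro _ ⟨k, hk, x, hx, rfl⟩
  exact h k hk x hx

lemma le_omega {f : ℝ → ℝ} {δ C : ℝ}
    (h : ∀ h ∈ Icc (0 : ℝ) δ, ∀ x ∈ Icc (h ^ 2 / (1 + h ^ 2)) (1 / (1 + h ^ 2)),
      |f (x + h * phi x) - 2 * f x + f (x - h * phi x)| ≤ C) {k x : ℝ}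
    (hk : k ∈ Icc (0 : ℝ) δ) (hx : x ∈ Icc (k ^ 2 / (1 + k ^ 2)) (1 / (1 + k ^ 2))) :
    |f (x + k * phi x) - 2 * f x + f (x - k * phi x)| ≤ omega2phi f δ := by
  unfold omega2phi
  refine le_csSup ⟨C, ?_⟩ ⟨k, hk, x, hx, rfl⟩
  rintro _ ⟨k, hk, x, hx, rfl⟩
  exact h k hk x hx

/-- **Theorem 1.** For any `f ∈ C²[0,1]` and any `μ₀ ∈ (0,1)` there exists `n₁` such that
for all `n ≥ n₁`, `(μ₀/32)·ω²_φ(f,1/√n) ≤ ‖f - B_n f‖ ≤ 3·ω²_φ(f,1/√n)`. -/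
theorem bernstein_lower_upper_estimate
    (f : ℝ → ℝ) (hf : ContDiffOn ℝ 2 f (Set.Icc 0 1))
    (μ₀ : ℝ) (hμ₀ : μ₀ ∈ Set.Ioo (0 : ℝ) 1) :
    ∃ n₁ : ℕ, ∀ n : ℕ, n₁ ≤ n →
      μ₀ / 32 * omega2phi f (1 / Real.sqrt n) ≤ supNorm (fun x => f x - bern n f x) ∧
      supNorm (fun x => f x - bern n f x) ≤ 3 * omega2phi f (1 / Real.sqrt n) := by
  obtain ⟨f1, f2, hd1, hd2, hc⟩ : ∃ f1 f2 : ℝ → ℝ,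
      (∀ x ∈ Icc (0 : ℝ) 1, HasDerivWithinAt f (f1 x) (Icc 0 1) x) ∧
      (∀ x ∈ Icc (0 : ℝ) 1, HasDerivWithinAt f1 (f2 x) (Icc 0 1) x) ∧
      ContinuousOn f2 (Icc 0 1) := by
    have hu : UniqueDiffOn ℝ (Icc (0 : ℝ) 1) := uniqueDiffOn_Icc zero_lt_one
    have hf1 : ContDiffOn ℝ 1 (derivWithin f (Icc 0 1)) (Icc 0 1) :=
      hf.derivWithin hu (by norm_num)
    have hf2 : ContinuousOn (derivWithin (derivWithin f (Icc 0 1)) (Icc 0 1)) (Icc 0 1) :=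
      hf1.continuousOn_derivWithin hu (by norm_num)
    exact ⟨_, _, fun x hx => (hf.differentiableOn (by norm_num) x hx).hasDerivWithinAt,
      fun x hx => (hf1.differentiableOn (by norm_num) x hx).hasDerivWithinAt, hf2⟩
  obtain ⟨x₀, hx₀, hmax⟩ := isCompact_Icc.exists_isMaxOn (s := Icc (0 : ℝ) 1)
    (f := fun x => |x * (1 - x) * f2 x|) ⟨0, by simp⟩ (by fun_prop)
  obtain ⟨M, hM⟩ : ∃ M, M = |x₀ * (1 - x₀) * f2 x₀| := ⟨_, rfl⟩
  have hmax' : ∀ x ∈ Icc (0 : ℝ) 1, |x * (1 - x) * f2 x| ≤ M := by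
    intro x hx; rw [hM]; exact hmax hx
  have hq : ∀ x ∈ Icc (0 : ℝ) 1, 0 ≤ x * (1 - x) ∧ x * (1 - x) ≤ 1 / 4 := by
    intro x hx
    exact ⟨mul_nonneg hx.1 (by linarith [hx.2]), by nlinarith [sq_nonneg (x - 1 / 2)]⟩
  rcases eq_or_lt_of_le (show 0 ≤ M by rw [hM]; positivity) with h0 | hpos
  · -- degenerate case
    have hz : EqOn f2 0 (Ioo 0 1) := by
      intro x hx
      have := hmax' x (Ioo_subset_Icc_self hx)
      rw [← h0] at this
      have h2 := abs_nonpos_iff.1 this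
      have h3 : x * (1 - x) ≠ 0 := (mul_pos hx.1 (by linarith [hx.2])).ne'
      simpa [h3] using h2
    have hz' : EqOn f2 0 (Icc 0 1) :=
      hz.of_subset_closure hc continuousOn_const Ioo_subset_Icc_self
        (by rw [closure_Ioo zero_ne_one])
    have H : TaylorH f f1 f2 0 0 := by
      intro x hx t ht
      have := taylor_basic hd1 hd2 hx ht (η := 0) (by
        intro ξ hξ
        have hsub : uIcc x t ⊆ Icc (0 : ℝ) 1 := by
          exact uIcc_subset_Icc hx ht
        rw [hz' (hsub hξ), hz' hx]; simp)
      simpa using this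
    refine ⟨1, fun n hn => ?_⟩
    have hn' : (0 : ℝ) < n := by exact_mod_cast hn
    have A : ∀ x ∈ Icc (0 : ℝ) 1, |f x - bern n f x| ≤ 0 := by
      intro x hx
      have := bern_est le_rfl H n hn x hx
      rw [hz' hx] at this
      simp at this
      rw [abs_sub_comm]
      exact nonpos_of_mul_nonpos_right this hn'
    have B : ∀ h ∈ Icc (0 : ℝ) (1 / √n), ∀ x ∈ Icc (h ^ 2 / (1 + h ^ 2)) (1 / (1 + h ^ 2)),
        |f (x + h * phi x) - 2 * f x + f (x - h * phi x)| ≤ 0 := by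
      intro h hh x hx
      have := delta_est le_rfl H hh.1 hx
      rw [hz' (range_mem hx)] at this
      simpa using this
    have A1 := supNorm_le (g := fun x => f x - bern n f x) A
    have A2 := (abs_nonneg _).trans
      (le_supNorm (g := fun x => f x - bern n f x) A (x := 0) (by simp))
    have B1 := omega_le (by positivity) B
    have B2 := (abs_nonneg _).trans
      (le_omega B (k := 0) (x := 0) ⟨le_rfl, by positivity⟩ (by simp))
    have A3 := le_antisymm A1 A2
    have B3 := le_antisymm B1 B2
    rw [A3, B3]; simp
  · -- main case
    obtain ⟨b, hb, H⟩ := exists_taylor hd1 hd2 hc (show 0 < M / 10 by positivity)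
    have hx₀' : 0 < x₀ ∧ 0 < 1 - x₀ := by
      constructor
      · refine lt_of_le_of_ne hx₀.1 ?_
        rintro rfl
        simp at hM; linarith
      · refine lt_of_le_of_ne (by linarith [hx₀.2]) ?_
        intro h
        rw [← h] at hM
        simp at hM; linarith
    obtain ⟨N, hN⟩ := exists_nat_ge (1 + b / (M / 10) + 1 / x₀ + 1 / (1 - x₀))
    refine ⟨N, fun n hn => ?_⟩
    have hNn : (N : ℝ) ≤ n := by exact_mod_cast hn
    have p1 : 0 ≤ b / (M / 10) := by positivity
    have p2 : 0 < 1 / x₀ := one_div_pos.2 hx₀'.1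
    have p3 : 0 < 1 / (1 - x₀) := one_div_pos.2 hx₀'.2
    have hn1 : (1 : ℝ) ≤ n := by linarith
    have hn' : (0 : ℝ) < n := by linarith
    have hn0 : 0 < n := by exact_mod_cast hn'
    have hbn : b / n ≤ M / 10 := by
      have : b / (M / 10) ≤ n := by linarith
      rw [div_le_iff₀ (by positivity)] at this
      rw [div_le_iff₀ hn']; linarith
    have A : ∀ x ∈ Icc (0 : ℝ) 1,
        |n * (bern n f x - f x) - x * (1 - x) * f2 x / 2| ≤ M / 10 := by
      intro x hx
      refine (bern_est hb H n hn0 x hx).trans ?_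
      obtain ⟨q0, q1⟩ := hq x hx
      have e : 2 * b / n = 2 * (b / n) := by ring
      rw [e]
      have hbn0 : 0 ≤ b / n := by positivity
      nlinarith
    have B : ∀ h ∈ Icc (0 : ℝ) (1 / √n), ∀ x ∈ Icc (h ^ 2 / (1 + h ^ 2)) (1 / (1 + h ^ 2)),
        |f (x + h * phi x) - 2 * f x + f (x - h * phi x) - h ^ 2 * (x * (1 - x) * f2 x)|
          ≤ h ^ 2 * (M / 10) ∧ h ^ 2 ≤ 1 / n := by
      intro h hh x hx
      obtain ⟨q0, q1⟩ := hq x (range_mem hx)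
      have hs : h ^ 2 ≤ 1 / n := by
        have : h ^ 2 ≤ (1 / √n) ^ 2 := pow_le_pow_left₀ hh.1 hh.2 2
        rwa [div_pow, one_pow, Real.sq_sqrt hn'.le] at this
      refine ⟨(delta_est hb H hh.1 hx).trans ?_, hs⟩
      refine mul_le_mul_of_nonneg_left ?_ (sq_nonneg h)
      have : b * h ^ 2 ≤ M / 10 := by
        refine le_trans (mul_le_mul_of_nonneg_left hs hb) ?_
        rw [mul_one_div]; exact hbn
      have : 0 ≤ b * h ^ 2 := by positivity
      nlinarith
    have A' : ∀ x ∈ Icc (0 : ℝ) 1, |f x - bern n f x| ≤ 6 / 10 * M / n := by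
      intro x hx
      have h1 := A x hx
      have h2 := hmax' x hx
      rw [le_div_iff₀ hn', ← abs_of_pos hn', ← abs_mul]
      rw [abs_le] at *
      constructor <;> linarith
    have A'' : 4 / 10 * M / n ≤ |f x₀ - bern n f x₀| := by
      have h1 := A x₀ hx₀
      rw [div_le_iff₀ hn', ← abs_of_pos hn', ← abs_mul]
      have h2 := abs_sub_abs_le_abs_sub (x₀ * (1 - x₀) * f2 x₀ / 2) (n * (bern n f x₀ - f x₀))
      rw [abs_sub_comm (x₀ * (1 - x₀) * f2 x₀ / 2), abs_div, ← hM, abs_two] at h2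
      rw [show (f x₀ - bern n f x₀) * n = -(n * (bern n f x₀ - f x₀)) by ring, abs_neg]
      linarith
    have B' : ∀ h ∈ Icc (0 : ℝ) (1 / √n), ∀ x ∈ Icc (h ^ 2 / (1 + h ^ 2)) (1 / (1 + h ^ 2)),
        |f (x + h * phi x) - 2 * f x + f (x - h * phi x)| ≤ 11 / 10 * M / n := by
      intro h hh x hx
      obtain ⟨h1, hs⟩ := B h hh x hx
      have h2 := hmax' x (range_mem hx)
      have h3 := abs_sub_abs_le_abs_sub (f (x + h * phi x) - 2 * f x + f (x - h * phi x))
        (h ^ 2 * (x * (1 - x) * f2 x))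
      rw [abs_mul (h ^ 2), abs_of_nonneg (sq_nonneg h)] at h3
      have h4 : h ^ 2 * |x * (1 - x) * f2 x| ≤ h ^ 2 * M :=
        mul_le_mul_of_nonneg_left h2 (sq_nonneg h)
      have h5 : h ^ 2 * (11 / 10 * M) ≤ 1 / n * (11 / 10 * M) :=
        mul_le_mul_of_nonneg_right hs (by positivity)
      have h6 : 1 / n * (11 / 10 * M) = 11 / 10 * M / n := by ring
      linarith
    have hk2 : (1 / √(n : ℝ)) ^ 2 = 1 / n := by rw [div_pow, one_pow, Real.sq_sqrt hn'.le]
    have hxr : x₀ ∈ Icc ((1 / √(n : ℝ)) ^ 2 / (1 + (1 / √(n : ℝ)) ^ 2))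
        (1 / (1 + (1 / √(n : ℝ)) ^ 2)) := by
      rw [hk2]
      have r1 : 1 / n ≤ x₀ := by
        rw [div_le_iff₀ hn', mul_comm, ← div_le_iff₀ hx₀'.1]; linarith
      have r2 : 1 / n ≤ 1 - x₀ := by
        rw [div_le_iff₀ hn', mul_comm, ← div_le_iff₀ hx₀'.2]; linarith
      have r3 : (0 : ℝ) < 1 / n := by positivity
      constructor
      · rw [div_le_iff₀ (by positivity)]; nlinarith
      · rw [le_div_iff₀ (by positivity)]; nlinarith
    have hk : 1 / √(n : ℝ) ∈ Icc (0 : ℝ) (1 / √n) := ⟨by positivity, le_rfl⟩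
    have B'' : 9 / 10 * M / n ≤ omega2phi f (1 / √n) := by
      refine le_trans ?_ (le_omega B' hk hxr)
      have h1 := (B _ hk x₀ hxr).1
      have h2 := abs_sub_abs_le_abs_sub ((1 / √(n : ℝ)) ^ 2 * (x₀ * (1 - x₀) * f2 x₀))
        (f (x₀ + 1 / √n * phi x₀) - 2 * f x₀ + f (x₀ - 1 / √n * phi x₀))
      rw [abs_sub_comm ((1 / √(n : ℝ)) ^ 2 * (x₀ * (1 - x₀) * f2 x₀)),
        abs_mul ((1 / √(n : ℝ)) ^ 2), ← hM, abs_of_nonneg (sq_nonneg _)] at h2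
      rw [hk2] at h1 h2
      have h6 : 1 / n * M - 1 / n * (M / 10) = 9 / 10 * M / n := by ring
      linarith
    have A1 := supNorm_le (g := fun x => f x - bern n f x) A'
    have A2 := A''.trans (le_supNorm (g := fun x => f x - bern n f x) A' hx₀)
    have B1 := omega_le (by positivity) B'
    obtain ⟨m0, m1⟩ := hμ₀
    have hMn : 0 < M / n := by positivity
    have c1 : 11 / 10 * M / n = 11 / 10 * (M / n) := by ring
    have c2 : 9 / 10 * M / n = 9 / 10 * (M / n) := by ring
    have c3 : 6 / 10 * M / n = 6 / 10 * (M / n) := by ring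
    have c4 : 4 / 10 * M / n = 4 / 10 * (M / n) := by ring
    rw [c1] at B1
    rw [c2] at B''
    rw [c3] at A1
    rw [c4] at A2
    constructor
    · refine le_trans ?_ A2
      have : μ₀ / 32 * omega2phi f (1 / √n) ≤ 1 / 32 * omega2phi f (1 / √n) :=
        mul_le_mul_of_nonneg_right (by linarith) (by linarith)
      linarith
    · linarith
end

section
/- Let M, m > 0 and let f ∈ C³[0,1] satisfy ‖f‴‖ ≤ M and |f″(x)| ≥ m for all x ∈ [0,1]. Then for all n ≥ n₁ where n₁ = ⌊1024·M²/m²⌋ + 1, it holds that (1/64)·ω²_φ(f, 1/√n) ≤ ‖f − B_n f‖ ≤ 3·ω²_φ(f, 1/√n). -/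
open Real Set Filter

/-- Centered moments of the binomial distribution. -/
noncomputable def cmom (n : ℕ) (x : ℝ) (j : ℕ) : ℝ :=
  ∑ k ∈ Finset.range (n + 1), ((n.choose k : ℝ) * x ^ k * (1 - x) ^ (n - k)) * ((k : ℝ) - n * x) ^ j

lemma bsum_succ (n : ℕ) (x : ℝ) (g : ℕ → ℝ) :
    ∑ k ∈ Finset.range (n + 2), (((n + 1).choose k : ℝ) * x ^ k * (1 - x) ^ (n + 1 - k)) * g k =
      x * (∑ k ∈ Finset.range (n + 1), ((n.choose k : ℝ) * x ^ k * (1 - x) ^ (n - k)) * g (k + 1))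
      + (1 - x) * (∑ k ∈ Finset.range (n + 1), ((n.choose k : ℝ) * x ^ k * (1 - x) ^ (n - k)) * g k) := by
  rw [Finset.sum_range_succ']
  have h1 : (1 - x) * (∑ k ∈ Finset.range (n + 1),
      ((n.choose k : ℝ) * x ^ k * (1 - x) ^ (n - k)) * g k)
      = (∑ k ∈ Finset.range (n + 1),
        ((n.choose (k + 1) : ℝ) * x ^ (k + 1) * (1 - x) ^ (n - k)) * g (k + 1))
        + (1 - x) ^ (n + 1) * g 0 := by
    rw [Finset.sum_range_succ', Finset.sum_range_succ (n := n), mul_add, Finset.mul_sum]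
    simp only [Nat.choose_succ_self, Nat.cast_zero, zero_mul, add_zero]
    congr 1
    · refine Finset.sum_congr rfl fun k hk => ?_
      have hk' : k < n := Finset.mem_range.1 hk
      have : n - k = (n - (k + 1)) + 1 := by omega
      rw [this, pow_succ]; ring
    · simp; ring
  rw [h1, Finset.mul_sum, ← add_assoc, ← Finset.sum_add_distrib]
  congr 1
  · refine Finset.sum_congr rfl fun k hk => ?_
    rw [Nat.choose_succ_succ]
    have : n + 1 - (k + 1) = n - k := by omega
    rw [this]; push_cast; ring
  · simp

lemma cmom_all (n : ℕ) (x : ℝ) :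
    cmom n x 0 = 1 ∧ cmom n x 1 = 0 ∧ cmom n x 2 = n * (x * (1 - x)) ∧
    cmom n x 3 = n * (x * (1 - x)) * (1 - 2 * x) ∧
    cmom n x 4 = 3 * n ^ 2 * (x * (1 - x)) ^ 2 + n * (x * (1 - x)) * (1 - 6 * (x * (1 - x))) := by
  induction n with
  | zero => simp [cmom]
  | succ n ih =>
    obtain ⟨h0, h1, h2, h3, h4⟩ := ih
    have key : ∀ j, cmom (n + 1) x j =
        x * (∑ k ∈ Finset.range (n + 1), ((n.choose k : ℝ) * x ^ k * (1 - x) ^ (n - k)) *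
          (((k : ℝ) - n * x) + (1 - x)) ^ j)
        + (1 - x) * (∑ k ∈ Finset.range (n + 1), ((n.choose k : ℝ) * x ^ k * (1 - x) ^ (n - k)) *
          (((k : ℝ) - n * x) + (-x)) ^ j) := by
      intro j
      unfold cmom
      rw [bsum_succ n x (fun k => ((k : ℝ) - ((n + 1 : ℕ) : ℝ) * x) ^ j)]
      congr 2
      · refine Finset.sum_congr rfl fun k hk => ?_
        push_cast; ring
      · refine Finset.sum_congr rfl fun k hk => ?_
        push_cast; ring
    have e0 : ∀ c : ℝ, ∑ k ∈ Finset.range (n + 1), ((n.choose k : ℝ) * x ^ k * (1 - x) ^ (n - k)) *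
          (((k : ℝ) - n * x) + c) ^ 0 = cmom n x 0 := by
      intro c; unfold cmom; simp
    have e1 : ∀ c : ℝ, ∑ k ∈ Finset.range (n + 1), ((n.choose k : ℝ) * x ^ k * (1 - x) ^ (n - k)) *
          (((k : ℝ) - n * x) + c) ^ 1 = cmom n x 1 + c * cmom n x 0 := by
      intro c; unfold cmom
      simp only [Finset.mul_sum, ← Finset.sum_add_distrib]
      exact Finset.sum_congr rfl fun k hk => by ring
    have e2 : ∀ c : ℝ, ∑ k ∈ Finset.range (n + 1), ((n.choose k : ℝ) * x ^ k * (1 - x) ^ (n - k)) *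
          (((k : ℝ) - n * x) + c) ^ 2 = cmom n x 2 + 2 * c * cmom n x 1 + c ^ 2 * cmom n x 0 := by
      intro c; unfold cmom
      simp only [Finset.mul_sum, ← Finset.sum_add_distrib]
      exact Finset.sum_congr rfl fun k hk => by ring
    have e3 : ∀ c : ℝ, ∑ k ∈ Finset.range (n + 1), ((n.choose k : ℝ) * x ^ k * (1 - x) ^ (n - k)) *
          (((k : ℝ) - n * x) + c) ^ 3 = cmom n x 3 + 3 * c * cmom n x 2 + 3 * c ^ 2 * cmom n x 1
            + c ^ 3 * cmom n x 0 := by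
      intro c; unfold cmom
      simp only [Finset.mul_sum, ← Finset.sum_add_distrib]
      exact Finset.sum_congr rfl fun k hk => by ring
    have e4 : ∀ c : ℝ, ∑ k ∈ Finset.range (n + 1), ((n.choose k : ℝ) * x ^ k * (1 - x) ^ (n - k)) *
          (((k : ℝ) - n * x) + c) ^ 4 = cmom n x 4 + 4 * c * cmom n x 3 + 6 * c ^ 2 * cmom n x 2
            + 4 * c ^ 3 * cmom n x 1 + c ^ 4 * cmom n x 0 := by
      intro c; unfold cmom
      simp only [Finset.mul_sum, ← Finset.sum_add_distrib]
      exact Finset.sum_congr rfl fun k hk => by ring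
    rw [key 0, key 1, key 2, key 3, key 4]
    simp only [e0, e1, e2, e3, e4, h0, h1, h2, h3, h4]
    push_cast
    refine ⟨by ring, by ring, by ring, by ring, by ring⟩

lemma deriv_bound_step (F F' : ℝ → ℝ) (x y C : ℝ) (hx : x ∈ Icc (0 : ℝ) 1) (hy : y ∈ Icc (0 : ℝ) 1)
    (hF : ∀ z ∈ Icc (0 : ℝ) 1, HasDerivWithinAt F (F' z) (Icc 0 1) z)
    (hb : ∀ z ∈ Icc (0 : ℝ) 1, |z - x| ≤ |y - x| → |F' z| ≤ C) :
    |F y - F x| ≤ C * |y - x| := by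
  have hsub : uIcc x y ⊆ Icc (0 : ℝ) 1 := by
    rw [← uIcc_of_le (zero_le_one' ℝ)] at hx hy ⊢
    exact uIcc_subset_uIcc hx hy
  have := (convex_uIcc x y).norm_image_sub_le_of_norm_hasDerivWithin_le (f := F) (f' := F') (C := C)
    (fun z hz => (hF z (hsub hz)).mono hsub)
    (fun z hz => hb z (hsub hz) (abs_sub_left_of_mem_uIcc hz)) left_mem_uIcc right_mem_uIcc
  simpa [Real.norm_eq_abs] using this

lemma taylor3 (f f1 f2 f3 : ℝ → ℝ) (M : ℝ) (hM : 0 < M)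
    (h1 : ∀ z ∈ Icc (0 : ℝ) 1, HasDerivWithinAt f (f1 z) (Icc 0 1) z)
    (h2 : ∀ z ∈ Icc (0 : ℝ) 1, HasDerivWithinAt f1 (f2 z) (Icc 0 1) z)
    (h3 : ∀ z ∈ Icc (0 : ℝ) 1, HasDerivWithinAt f2 (f3 z) (Icc 0 1) z)
    (hb : ∀ z ∈ Icc (0 : ℝ) 1, |f3 z| ≤ M) :
    (∀ x ∈ Icc (0 : ℝ) 1, ∀ y ∈ Icc (0 : ℝ) 1, |f2 y - f2 x| ≤ M * |y - x|) ∧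
    (∀ x ∈ Icc (0 : ℝ) 1, ∀ y ∈ Icc (0 : ℝ) 1,
      |f y - f x - f1 x * (y - x) - f2 x * (y - x) ^ 2 / 2| ≤ M * |y - x| ^ 3) := by
  have A : ∀ x ∈ Icc (0 : ℝ) 1, ∀ y ∈ Icc (0 : ℝ) 1, |f2 y - f2 x| ≤ M * |y - x| :=
    fun x hx y hy => deriv_bound_step f2 f3 x y M hx hy h3 (fun z hz _ => hb z hz)
  have B : ∀ x ∈ Icc (0 : ℝ) 1, ∀ y ∈ Icc (0 : ℝ) 1,
      |f1 y - f1 x - f2 x * (y - x)| ≤ M * |y - x| ^ 2 := by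
    intro x hx y hy
    have := deriv_bound_step (fun z => f1 z - f2 x * (z - x)) (fun z => f2 z - f2 x * 1) x y
      (M * |y - x|) hx hy
      (fun z hz => (h2 z hz).sub (((hasDerivWithinAt_id z _).sub_const x).const_mul (f2 x)))
      (fun z hz hzx => by
        rw [mul_one]
        exact (A x hx z hz).trans (mul_le_mul_of_nonneg_left hzx hM.le))
    calc _ = |(f1 y - f2 x * (y - x)) - (f1 x - f2 x * (x - x))| := by congr 1; ring
      _ ≤ _ := this
      _ = _ := by ring
  refine ⟨A, fun x hx y hy => ?_⟩
  have := deriv_bound_step (fun z => f z - f1 x * (z - x) - f2 x * (z - x) ^ 2 / 2)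
      (fun z => f1 z - f1 x * 1 - f2 x * (2 * (z - x)) / 2) x y
      (M * |y - x| ^ 2) hx hy
      (fun z hz => by
        have hd := (hasDerivWithinAt_id z (Icc (0 : ℝ) 1)).sub_const x
        have hd2 := hd.pow 2
        refine ((h1 z hz).sub (hd.const_mul (f1 x))).sub
          (HasDerivWithinAt.div_const (HasDerivWithinAt.const_mul (f2 x) ?_) 2)
        have e : (2 : ℝ) * (z - x) = ((2 : ℕ) : ℝ) * (id z - x) ^ (2 - 1) * 1 := by simp
        rw [e]
        exact hd2)
      (fun z hz hzx => by
        have h := B x hx z hz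
        have e : f1 z - f1 x * 1 - f2 x * (2 * (z - x)) / 2 = f1 z - f1 x - f2 x * (z - x) := by ring
        rw [e]
        refine h.trans (mul_le_mul_of_nonneg_left ?_ hM.le)
        gcongr)
  calc _ = |(f y - f1 x * (y - x) - f2 x * (y - x) ^ 2 / 2)
      - (f x - f1 x * (x - x) - f2 x * (x - x) ^ 2 / 2)| := by congr 1; ring
    _ ≤ _ := this
    _ = _ := by ring

/-- Voronovskaya-type estimate. -/
lemma voron (f f1 f2 : ℝ → ℝ) (M : ℝ) (hM : 0 < M)
    (hT : ∀ x ∈ Icc (0 : ℝ) 1, ∀ y ∈ Icc (0 : ℝ) 1,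
      |f y - f x - f1 x * (y - x) - f2 x * (y - x) ^ 2 / 2| ≤ M * |y - x| ^ 3)
    (n : ℕ) (hn : 1 ≤ n) (δ : ℝ) (hδ : 0 < δ) (hδn : δ ^ 2 * n = 1)
    (x : ℝ) (hx : x ∈ Icc (0 : ℝ) 1) :
    |bern n f x - f x - f2 x * (δ ^ 2 * (x * (1 - x))) / 2| ≤
      11 / 8 * M * δ * (δ ^ 2 * (x * (1 - x))) := by
  obtain ⟨m0, m1, m2, m3, m4⟩ := cmom_all n x
  have hn0 : (0 : ℝ) < n := by exact_mod_cast hn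
  have hx1 : 0 ≤ 1 - x := by linarith [hx.2]
  set w : ℕ → ℝ := fun k => (n.choose k : ℝ) * x ^ k * (1 - x) ^ (n - k) with hw
  have hw0 : ∀ k, 0 ≤ w k := fun k => by
    have := hx.1
    simp only [hw]; positivity
  have hd : ∀ k : ℕ, (k : ℝ) / n - x = δ ^ 2 * ((k : ℝ) - n * x) := by
    intro k
    have : δ ^ 2 = 1 / n := by field_simp; linarith
    rw [this]; field_simp
  have E1 : bern n f x - f x - f2 x * (δ ^ 2 * (x * (1 - x))) / 2 =
      ∑ k ∈ Finset.range (n + 1), w k * (f ((k : ℝ) / n) - f x - f1 x * ((k : ℝ) / n - x)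
        - f2 x * ((k : ℝ) / n - x) ^ 2 / 2) := by
    have : ∑ k ∈ Finset.range (n + 1), w k * (f ((k : ℝ) / n) - f x - f1 x * ((k : ℝ) / n - x)
        - f2 x * ((k : ℝ) / n - x) ^ 2 / 2) = bern n f x - f x * cmom n x 0
          - f1 x * δ ^ 2 * cmom n x 1 - f2 x * δ ^ 4 / 2 * cmom n x 2 := by
      unfold bern cmom
      simp only [Finset.mul_sum, ← Finset.sum_sub_distrib]
      refine Finset.sum_congr rfl fun k hk => ?_
      rw [hd k]
      simp only [hw]; ring
    rw [this, m0, m1, m2]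
    have : δ ^ 4 * n = δ ^ 2 := by linear_combination δ ^ 2 * hδn
    linear_combination (f2 x * (x * (1 - x)) / 2) * this
  rw [E1]
  have hp : 0 ≤ x * (1 - x) := mul_nonneg hx.1 hx1
  have hp4 : x * (1 - x) ≤ 1 / 4 := by nlinarith [sq_nonneg (x - 1 / 2)]
  have cube : ∀ t : ℝ, |t| ^ 3 ≤ δ / 2 * t ^ 2 + 1 / (2 * δ) * t ^ 4 := by
    intro t
    have e2 : t ^ 2 = |t| ^ 2 := (sq_abs t).symm
    have e4 : t ^ 4 = |t| ^ 4 := by rw [show (4 : ℕ) = 2 * 2 by rfl, pow_mul, pow_mul, sq_abs]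
    rw [e2, e4]
    have : δ / 2 * |t| ^ 2 + 1 / (2 * δ) * |t| ^ 4 - |t| ^ 3 = |t| ^ 2 * (δ - |t|) ^ 2 / (2 * δ) := by
      field_simp; ring
    have h : 0 ≤ |t| ^ 2 * (δ - |t|) ^ 2 / (2 * δ) := by positivity
    linarith
  calc _ ≤ ∑ k ∈ Finset.range (n + 1), |w k * (f ((k : ℝ) / n) - f x - f1 x * ((k : ℝ) / n - x)
        - f2 x * ((k : ℝ) / n - x) ^ 2 / 2)| := Finset.abs_sum_le_sum_abs _ _
    _ ≤ ∑ k ∈ Finset.range (n + 1), w k * (M * (δ / 2 * ((k : ℝ) / n - x) ^ 2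
        + 1 / (2 * δ) * ((k : ℝ) / n - x) ^ 4)) := by
      refine Finset.sum_le_sum fun k hk => ?_
      rw [abs_mul, abs_of_nonneg (hw0 k)]
      refine mul_le_mul_of_nonneg_left ?_ (hw0 k)
      refine (hT x hx ((k : ℝ) / n) ⟨by positivity, ?_⟩).trans
        (mul_le_mul_of_nonneg_left (cube _) hM.le)
      rw [div_le_one hn0]
      exact_mod_cast Nat.lt_succ_iff.1 (Finset.mem_range.1 hk)
    _ = M * (δ / 2) * δ ^ 4 * cmom n x 2 + M * (1 / (2 * δ)) * δ ^ 8 * cmom n x 4 := by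
      unfold cmom
      simp only [Finset.mul_sum, ← Finset.sum_add_distrib]
      refine Finset.sum_congr rfl fun k hk => ?_
      rw [hd k]
      simp only [hw]; ring
    _ = M * δ ^ 3 * (x * (1 - x)) / 2 * (1 + 3 * (x * (1 - x)) + δ ^ 2 * (1 - 6 * (x * (1 - x)))) := by
      rw [m2, m4]
      have hN : (n : ℝ) = 1 / δ ^ 2 := by field_simp; linarith
      rw [hN]; field_simp; ring
    _ ≤ M * δ ^ 3 * (x * (1 - x)) / 2 * (11 / 4) := by
      have hδ1 : δ ^ 2 ≤ 1 := by
        have : (1 : ℝ) ≤ n := by exact_mod_cast hn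
        nlinarith [sq_nonneg δ]
      refine mul_le_mul_of_nonneg_left ?_ (by positivity)
      nlinarith [sq_nonneg δ, mul_nonneg (sq_nonneg δ) hp]
    _ = _ := by ring

lemma secdiff (f f1 f2 : ℝ → ℝ) (M : ℝ) (hM : 0 < M)
    (hT : ∀ x ∈ Icc (0 : ℝ) 1, ∀ y ∈ Icc (0 : ℝ) 1,
      |f y - f x - f1 x * (y - x) - f2 x * (y - x) ^ 2 / 2| ≤ M * |y - x| ^ 3)
    (h x : ℝ) (h0 : 0 ≤ h) (hx : x ∈ Icc (h ^ 2 / (1 + h ^ 2)) (1 / (1 + h ^ 2))) :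
    x ∈ Icc (0 : ℝ) 1 ∧
    |f (x + h * phi x) - 2 * f x + f (x - h * phi x) - f2 x * (h ^ 2 * (x * (1 - x)))| ≤
      M * h * (h ^ 2 * (x * (1 - x))) := by
  have hpos : 0 < 1 + h ^ 2 := by positivity
  have a1 : h ^ 2 ≤ x * (1 + h ^ 2) := (div_le_iff₀ hpos).1 hx.1
  have a2 : x * (1 + h ^ 2) ≤ 1 := (le_div_iff₀ hpos).1 hx.2
  have hx01 : x ∈ Icc (0 : ℝ) 1 := by
    constructor
    · exact le_trans (by positivity) hx.1
    · exact hx.2.trans (by rw [div_le_one hpos]; nlinarith)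
  refine ⟨hx01, ?_⟩
  have hp := phi_sq hx01
  have hp0 : 0 ≤ phi x := Real.sqrt_nonneg _
  have hd0 : 0 ≤ h * phi x := mul_nonneg h0 hp0
  have hdsq : (h * phi x) ^ 2 = h ^ 2 * (x * (1 - x)) := by rw [mul_pow, hp]
  have b1 : h * phi x ≤ x := by
    refine abs_le_of_sq_le_sq' ?_ hx01.1 |>.2
    rw [hdsq]; nlinarith [hx01.1]
  have b2 : h * phi x ≤ 1 - x := by
    refine abs_le_of_sq_le_sq' ?_ (by linarith [hx01.2]) |>.2
    rw [hdsq]; nlinarith [hx01.2]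
  have p2 : phi x ≤ 1 / 2 := by
    refine abs_le_of_sq_le_sq' ?_ (by norm_num) |>.2
    rw [hp]; nlinarith [sq_nonneg (x - 1 / 2)]
  have t1 := hT x hx01 (x + h * phi x) ⟨by linarith [hx01.1], by linarith⟩
  have t2 := hT x hx01 (x - h * phi x) ⟨by linarith, by linarith [hx01.2]⟩
  rw [show x + h * phi x - x = h * phi x by ring, abs_of_nonneg hd0, hdsq] at t1
  rw [show x - h * phi x - x = -(h * phi x) by ring, abs_neg, abs_of_nonneg hd0, neg_sq, hdsq] at t2
  have c : M * (h * phi x) ^ 3 ≤ M * h * (h ^ 2 * (x * (1 - x))) / 2 := by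
    rw [← hdsq]
    have : 0 ≤ M * (h * phi x) ^ 2 * h := by positivity
    nlinarith
  rw [abs_le] at t1 t2 ⊢
  constructor <;> linarith [t1.1, t1.2, t2.1, t2.2]

/-- **Corollary 1.** If `f ∈ C³[0,1]`, `‖f'''‖ ≤ M` and `|f''(x)| ≥ m` on `[0,1]`, then for all
`n ≥ ⌊1024 M²/m²⌋ + 1`, `(1/64)·ω²_φ(f,1/√n) ≤ ‖f - B_n f‖ ≤ 3·ω²_φ(f,1/√n)`. -/
theorem bernstein_lower_upper_estimate_C3
    (f : ℝ → ℝ) (M m : ℝ) (hM : 0 < M) (hm : 0 < m)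
    (hf : ContDiffOn ℝ 3 f (Set.Icc 0 1))
    (hf3 : supNorm (iteratedDerivWithin 3 f (Set.Icc 0 1)) ≤ M)
    (hf2 : ∀ x ∈ Set.Icc (0 : ℝ) 1, m ≤ |iteratedDerivWithin 2 f (Set.Icc 0 1) x|) :
    ∀ n : ℕ, Nat.floor (1024 * M ^ 2 / m ^ 2) + 1 ≤ n →
      1 / 64 * omega2phi f (1 / Real.sqrt n) ≤ supNorm (fun x => f x - bern n f x) ∧
      supNorm (fun x => f x - bern n f x) ≤ 3 * omega2phi f (1 / Real.sqrt n) := by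
  intro n hn
  have hn1 : 1 ≤ n := by omega
  have hn0 : (0 : ℝ) < n := by exact_mod_cast hn1
  have hud : UniqueDiffOn ℝ (Icc (0 : ℝ) 1) := uniqueDiffOn_Icc zero_lt_one
  have hder : ∀ j : ℕ, j < 3 → ∀ z ∈ Icc (0 : ℝ) 1,
      HasDerivWithinAt (iteratedDerivWithin j f (Icc 0 1))
        (iteratedDerivWithin (j + 1) f (Icc 0 1) z) (Icc 0 1) z := by
    intro j hj z hz
    rw [iteratedDerivWithin_succ]
    exact (hf.differentiableOn_iteratedDerivWithin (by exact_mod_cast hj) hud z hz).hasDerivWithinAt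
  have hb3 : ∀ z ∈ Icc (0 : ℝ) 1, |iteratedDerivWithin 3 f (Icc 0 1) z| ≤ M := by
    intro z hz
    refine le_trans (le_csSup (s := (fun x => |iteratedDerivWithin 3 f (Icc 0 1) x|) '' Icc 0 1)
      ?_ ⟨z, hz, rfl⟩) hf3
    exact isCompact_Icc.bddAbove_image
      (hf.continuousOn_iteratedDerivWithin (by norm_num) hud).abs
  set f1 := iteratedDerivWithin 1 f (Icc 0 1)
  set f2 := iteratedDerivWithin 2 f (Icc 0 1)
  obtain ⟨hL, hT⟩ := taylor3 f f1 f2 _ M hM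
    (by have := hder 0 (by norm_num); rwa [iteratedDerivWithin_zero] at this)
    (hder 1 (by norm_num)) (hder 2 (by norm_num)) hb3
  set δ : ℝ := 1 / Real.sqrt n with hδdef
  have hδ : 0 < δ := by positivity
  have hδn : δ ^ 2 * n = 1 := by
    rw [hδdef, div_pow, Real.sq_sqrt hn0.le]; field_simp
  have hδ1 : δ ≤ 1 := by
    have h1n : (1 : ℝ) ≤ n := by exact_mod_cast hn1
    nlinarith
  have hMδ : 32 * M * δ ≤ m := by
    have h1 : 1024 * M ^ 2 / m ^ 2 < n := Nat.lt_of_floor_lt (by omega)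
    rw [div_lt_iff₀ (by positivity)] at h1
    refine abs_le_of_sq_le_sq' ?_ hm.le |>.2
    have : (32 * M * δ) ^ 2 = 1024 * M ^ 2 * δ ^ 2 := by ring
    rw [this]
    have := mul_le_mul_of_nonneg_right h1.le (sq_nonneg δ)
    calc _ ≤ _ := this
      _ = m ^ 2 * (δ ^ 2 * n) := by ring
      _ = _ := by rw [hδn, mul_one]
  have hp0 : ∀ x ∈ Icc (0 : ℝ) 1, 0 ≤ δ ^ 2 * (x * (1 - x)) := fun x hx =>
    mul_nonneg (sq_nonneg δ) (mul_nonneg hx.1 (by linarith [hx.2]))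
  -- two-sided pointwise estimate for the Bernstein error
  have hV : ∀ x ∈ Icc (0 : ℝ) 1,
      2 / 5 * |f2 x| * (δ ^ 2 * (x * (1 - x))) ≤ |f x - bern n f x| ∧
      |f x - bern n f x| ≤ 3 / 5 * |f2 x| * (δ ^ 2 * (x * (1 - x))) := by
    intro x hx
    have v := voron f f1 f2 M hM hT n hn1 δ hδ hδn x hx
    have hp := hp0 x hx
    set p := δ ^ 2 * (x * (1 - x))
    have e : |f2 x * p / 2| = |f2 x| * p / 2 := by
      rw [abs_div, abs_mul, abs_of_nonneg hp, abs_two]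
    have c : 11 / 8 * M * δ * p ≤ 1 / 10 * |f2 x| * p := by
      refine mul_le_mul_of_nonneg_right ?_ hp
      have := hf2 x hx
      have : 0 < M * δ := by positivity
      linarith
    have t := abs_sub_abs_le_abs_sub (bern n f x - f x) (f2 x * p / 2)
    have t' := abs_sub_abs_le_abs_sub (f2 x * p / 2) (bern n f x - f x)
    rw [abs_sub_comm (f2 x * p / 2)] at t'
    rw [abs_sub_comm (f x)]
    rw [e] at t t'
    constructor <;> linarith
  have hD : ∀ h ∈ Icc (0 : ℝ) δ, ∀ x ∈ Icc (h ^ 2 / (1 + h ^ 2)) (1 / (1 + h ^ 2)),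
      x ∈ Icc (0 : ℝ) 1 ∧
      31 / 32 * |f2 x| * (h ^ 2 * (x * (1 - x))) ≤
        |f (x + h * phi x) - 2 * f x + f (x - h * phi x)| ∧
      |f (x + h * phi x) - 2 * f x + f (x - h * phi x)| ≤
        33 / 32 * |f2 x| * (h ^ 2 * (x * (1 - x))) := by
    intro h hh x hx
    obtain ⟨hx1, v⟩ := secdiff f f1 f2 M hM hT h x hh.1 hx
    refine ⟨hx1, ?_⟩
    have hp : 0 ≤ h ^ 2 * (x * (1 - x)) :=
      mul_nonneg (sq_nonneg h) (mul_nonneg hx1.1 (by linarith [hx1.2]))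
    set p := h ^ 2 * (x * (1 - x))
    set D := f (x + h * phi x) - 2 * f x + f (x - h * phi x)
    have e : |f2 x * p| = |f2 x| * p := by rw [abs_mul, abs_of_nonneg hp]
    have c : M * h * p ≤ 1 / 32 * |f2 x| * p := by
      refine mul_le_mul_of_nonneg_right ?_ hp
      have := hf2 x hx1
      have : M * h ≤ M * δ := mul_le_mul_of_nonneg_left hh.2 hM.le
      linarith
    have t := abs_sub_abs_le_abs_sub D (f2 x * p)
    have t' := abs_sub_abs_le_abs_sub (f2 x * p) D
    rw [abs_sub_comm (f2 x * p)] at t'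
    rw [e] at t t'
    constructor <;> linarith
  have hbdd : BddAbove ((fun x => |f x - bern n f x|) '' Icc 0 1) := by
    refine isCompact_Icc.bddAbove_image (hf.continuousOn.sub ?_).abs
    unfold bern
    fun_prop
  have hup : ∀ y ∈ {y : ℝ | ∃ h ∈ Set.Icc (0 : ℝ) δ,
      ∃ x ∈ Set.Icc (h ^ 2 / (1 + h ^ 2)) (1 / (1 + h ^ 2)),
      y = |f (x + h * phi x) - 2 * f x + f (x - h * phi x)|},
      y ≤ 64 * supNorm (fun x => f x - bern n f x) := by
    rintro y ⟨h, hh, x, hx, rfl⟩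
    obtain ⟨hx1, _, hu⟩ := hD h hh x hx
    have hs : |f x - bern n f x| ≤ supNorm (fun x => f x - bern n f x) :=
      le_csSup hbdd (mem_image_of_mem _ hx1)
    have hl := (hV x hx1).1
    have hxx : 0 ≤ x * (1 - x) := mul_nonneg hx1.1 (by linarith [hx1.2])
    have hh2 : h ^ 2 ≤ δ ^ 2 := pow_le_pow_left₀ hh.1 hh.2 2
    have : |f2 x| * (h ^ 2 * (x * (1 - x))) ≤ |f2 x| * (δ ^ 2 * (x * (1 - x))) := by gcongr
    have : 0 ≤ |f2 x| * (δ ^ 2 * (x * (1 - x))) := mul_nonneg (abs_nonneg _) (hp0 x hx1)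
    linarith
  constructor
  · have : omega2phi f δ ≤ 64 * supNorm (fun x => f x - bern n f x) := by
      refine csSup_le ⟨_, 0, ⟨le_rfl, hδ.le⟩, 0, by simp, rfl⟩ hup
    linarith
  · refine csSup_le ((nonempty_Icc.2 zero_le_one).image _) ?_
    rintro _ ⟨x, hx, rfl⟩
    have hpos : 0 < 1 + δ ^ 2 := by positivity
    have hδ2 : δ ^ 2 ≤ 1 := pow_le_one₀ hδ.le hδ1
    have hδ2' : δ ^ 2 ≤ δ := by nlinarith
    set a := δ ^ 2 / (1 + δ ^ 2) with ha
    have hb : 1 / (1 + δ ^ 2) = 1 - a := by rw [ha]; field_simp; ring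
    have ha0 : 0 ≤ a := by positivity
    have haδ : a ≤ δ := (div_le_self (sq_nonneg δ) (by linarith [sq_nonneg δ])).trans hδ2'
    have ha2 : a ≤ 1 / 2 := by rw [ha, div_le_iff₀ hpos]; linarith
    obtain ⟨y, hy, hyx, hyp⟩ : ∃ y ∈ Icc a (1 - a), |y - x| ≤ δ ∧ x * (1 - x) ≤ y * (1 - y) := by
      rcases lt_or_ge x a with h | h
      · refine ⟨a, ⟨le_rfl, by linarith⟩, ?_, by nlinarith⟩
        rw [abs_le]; constructor <;> linarith [hx.1]
      · rcases lt_or_ge (1 - a) x with h' | h'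
        · refine ⟨1 - a, ⟨by linarith, le_rfl⟩, ?_, by nlinarith⟩
          rw [abs_le]; constructor <;> linarith [hx.2]
        · exact ⟨x, ⟨h, h'⟩, by simpa using hδ.le, le_rfl⟩
    rw [← hb] at hy
    obtain ⟨hy1, hlow, _⟩ := hD δ ⟨hδ.le, le_rfl⟩ y hy
    have hom : |f (y + δ * phi y) - 2 * f y + f (y - δ * phi y)| ≤ omega2phi f δ :=
      le_csSup ⟨_, hup⟩ ⟨δ, ⟨hδ.le, le_rfl⟩, y, hy, rfl⟩
    have hu := (hV x hx).2
    have hlip := hL y hy1 x hx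
    have hg : 31 / 32 * |f2 x| ≤ |f2 y| := by
      have t := abs_sub_abs_le_abs_sub (f2 x) (f2 y)
      have : M * |x - y| ≤ M * δ := by
        rw [abs_sub_comm]; exact mul_le_mul_of_nonneg_left hyx hM.le
      have := hf2 x hx
      linarith
    have hq : 31 / 32 * |f2 x| * (δ ^ 2 * (x * (1 - x))) ≤ |f2 y| * (δ ^ 2 * (y * (1 - y))) :=
      mul_le_mul hg (mul_le_mul_of_nonneg_left hyp (sq_nonneg δ)) (hp0 x hx) (abs_nonneg _)
    have : 0 ≤ |f2 x| * (δ ^ 2 * (x * (1 - x))) := mul_nonneg (abs_nonneg _) (hp0 x hx)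
    show |f x - bern n f x| ≤ _
    linarith
end

section
/- Let f ∈ C²[0,1] and let λ₀ ∈ (0,1). Then there exists a natural number n₀ (depending on f and λ₀) such that for all n ≥ n₀, λ₀·(1/n)·‖φ²·f″‖ ≤ ω²_φ(f, 1/√n). -/
open Real Set Filter

/-- **Theorem 2.** For any `f ∈ C²[0,1]` and any `λ₀ ∈ (0,1)`, there exists `n₀` such that
for all `n ≥ n₀`, `λ₀·(1/n)·‖φ²f''‖ ≤ ω²_φ(f,1/√n)`. -/
theorem lower_modulus_estimate
    (f : ℝ → ℝ) (hf : ContDiffOn ℝ 2 f (Set.Icc 0 1))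
    (lam₀ : ℝ) (hlam₀ : lam₀ ∈ Set.Ioo (0 : ℝ) 1) :
    ∃ n₀ : ℕ, ∀ n : ℕ, n₀ ≤ n →
      lam₀ * (1 / n) *
          supNorm (fun x => phi x ^ 2 * iteratedDerivWithin 2 f (Set.Icc 0 1) x) ≤
        omega2phi f (1 / Real.sqrt n) := by
  obtain ⟨hl0, hl1⟩ := hlam₀
  set F := iteratedDerivWithin 2 f (Set.Icc 0 1) with hF
  have hFc : ContinuousOn F (Set.Icc 0 1) :=
    hf.continuousOn_iteratedDerivWithin (le_refl _) (uniqueDiffOn_Icc zero_lt_one)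
  have hphi : Continuous phi := by unfold phi; fun_prop
  have hGc : ContinuousOn (fun x => |phi x ^ 2 * F x|) (Set.Icc 0 1) :=
    ((hphi.pow 2).continuousOn.mul hFc).abs
  obtain ⟨x₀, hx₀, hmax⟩ := isCompact_Icc.exists_isMaxOn (nonempty_Icc.2 zero_le_one) hGc
  have hsup : supNorm (fun x => phi x ^ 2 * F x) ≤ |phi x₀ ^ 2 * F x₀| := by
    unfold supNorm
    apply csSup_le ((nonempty_Icc.2 zero_le_one).image _)
    rintro _ ⟨x, hx, rfl⟩
    exact hmax hx
  have hpnn : ∀ x, 0 ≤ phi x := fun x => Real.sqrt_nonneg _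
  by_cases hM : phi x₀ ^ 2 * F x₀ = 0
  · refine ⟨0, fun n _ => ?_⟩
    rw [hM, abs_zero] at hsup
    have h1 : 0 ≤ omega2phi f (1 / Real.sqrt n) := by
      unfold omega2phi
      apply Real.sSup_nonneg
      rintro y ⟨h, _, x, _, rfl⟩
      exact abs_nonneg _
    have h2 : 0 ≤ lam₀ * (1 / (n : ℝ)) := by positivity
    exact (mul_nonpos_of_nonneg_of_nonpos h2 hsup).trans h1
  have hF0 : F x₀ ≠ 0 := right_ne_zero_of_mul hM
  have hp0 : phi x₀ ≠ 0 := fun h => hM (by simp [h])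
  have hpp : 0 < phi x₀ := lt_of_le_of_ne (hpnn _) (Ne.symm hp0)
  have hxx : 0 < x₀ * (1 - x₀) := Real.sqrt_pos.1 hpp
  have hx0 : 0 < x₀ := lt_of_le_of_ne hx₀.1 (by rintro rfl; simp at hxx)
  have hx1 : x₀ < 1 := lt_of_le_of_ne hx₀.2 (by rintro rfl; simp at hxx)
  have hT := taylor_isLittleO (n := 2) (convex_Icc (0:ℝ) 1) hx₀ (by exact_mod_cast hf)
  have hc : 0 < (1 - lam₀) * |F x₀| / 2 := by
    have := abs_pos.2 hF0
    have : 0 < 1 - lam₀ := by linarith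
    positivity
  have hT2 := hT.bound hc
  rw [nhdsWithin_eq_nhds.2 (Icc_mem_nhds hx0 hx1)] at hT2
  have hT3 := hT2.and (Icc_mem_nhds hx0 hx1)
  obtain ⟨ε, hε, hball⟩ := Metric.eventually_nhds_iff.1 hT2
  have key : ∀ t : ℝ, |t| < ε → lam₀ * |F x₀| * t ^ 2 ≤ |f (x₀ + t) - 2 * f x₀ + f (x₀ - t)| := by
    intro t ht
    have h1 := @hball (x₀ + t) (by simpa [Real.dist_eq] using ht)
    have h2 := @hball (x₀ - t) (by simpa [Real.dist_eq] using ht)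
    simp only [taylorWithinEval_succ, taylor_within_zero_eval, Real.norm_eq_abs, smul_eq_mul] at h1 h2
    norm_num [Nat.factorial] at h1 h2
    rw [← hF] at h1 h2
    set D := derivWithin f (Set.Icc 0 1) x₀
    have h3 : |F x₀ * t ^ 2| ≤ |f (x₀ + t) - 2 * f x₀ + f (x₀ - t)| + (1 - lam₀) * |F x₀| * t ^ 2 := by
      rw [abs_le] at h1 h2
      have := neg_abs_le (f (x₀ + t) - 2 * f x₀ + f (x₀ - t))
      have := le_abs_self (f (x₀ + t) - 2 * f x₀ + f (x₀ - t))
      rw [abs_le]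
      constructor <;> nlinarith [h1.1, h1.2, h2.1, h2.2]
    rw [abs_mul, abs_of_nonneg (sq_nonneg t)] at h3
    linarith
  -- eventually h small
  have hlim : Tendsto (fun n : ℕ => 1 / Real.sqrt (n : ℝ)) atTop (nhds 0) := by
    simp only [one_div]
    exact tendsto_inv_atTop_zero.comp (Real.tendsto_sqrt_atTop.comp tendsto_natCast_atTop_atTop)
  have hlim1 : Tendsto (fun n : ℕ => (1 / Real.sqrt (n : ℝ)) * phi x₀) atTop (nhds 0) := by
    simpa using hlim.mul_const (phi x₀)
  have hlim2 : Tendsto (fun n : ℕ => (1 / Real.sqrt (n : ℝ)) ^ 2) atTop (nhds 0) := by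
    simpa using hlim.pow 2
  have e1 := hlim1.eventually (gt_mem_nhds hε)
  have e2 := hlim2.eventually (gt_mem_nhds hx0)
  have e3 := hlim2.eventually (gt_mem_nhds (show 0 < 1 - x₀ by linarith))
  obtain ⟨n₀, hn₀⟩ := eventually_atTop.1 (e1.and (e2.and e3))
  refine ⟨n₀, fun n hn => ?_⟩
  obtain ⟨a1, a2, a3⟩ := hn₀ n hn
  have hsq : (1 / Real.sqrt (n : ℝ)) ^ 2 = 1 / (n : ℝ) := by
    rw [div_pow, Real.sq_sqrt (Nat.cast_nonneg n), one_pow]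
  set h := 1 / Real.sqrt (n : ℝ) with hh
  have hh0 : 0 ≤ h := by positivity
  have hbdd : BddAbove {y : ℝ | ∃ k ∈ Set.Icc (0 : ℝ) h,
    ∃ x ∈ Set.Icc (k ^ 2 / (1 + k ^ 2)) (1 / (1 + k ^ 2)),
      y = |f (x + k * phi x) - 2 * f x + f (x - k * phi x)|} := by
    obtain ⟨C, hC⟩ := isCompact_Icc.exists_bound_of_continuousOn hf.continuousOn
    refine ⟨4 * C, ?_⟩
    rintro y ⟨k, hk, x, hx, rfl⟩
    have hk2 : 0 < 1 + k ^ 2 := by positivity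
    have b1 := (div_le_iff₀ hk2).1 hx.1
    have b2 := (le_div_iff₀ hk2).1 hx.2
    have hxn : 0 ≤ x := le_trans (by positivity) hx.1
    have hxl : x ≤ 1 := by nlinarith [mul_nonneg hxn (sq_nonneg k)]
    have hps : phi x ^ 2 = x * (1 - x) := Real.sq_sqrt (mul_nonneg hxn (by linarith))
    have hkp : 0 ≤ k * phi x := mul_nonneg hk.1 (hpnn x)
    have c1 : k * phi x ≤ x := by
      apply abs_le_of_sq_le_sq' _ hxn |>.2
      rw [mul_pow, hps]
      nlinarith
    have c2 : k * phi x ≤ 1 - x := by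
      apply abs_le_of_sq_le_sq' _ (by linarith : 0 ≤ 1 - x) |>.2
      rw [mul_pow, hps]
      nlinarith
    have d1 := hC x ⟨hxn, hxl⟩
    have d2 := hC (x + k * phi x) ⟨by linarith, by linarith⟩
    have d3 := hC (x - k * phi x) ⟨by linarith, by linarith⟩
    rw [Real.norm_eq_abs, abs_le] at d1 d2 d3
    rw [abs_le]
    constructor <;> linarith [d1.1, d1.2, d2.1, d2.2, d3.1, d3.2]
  have hk := key (h * phi x₀) (by rwa [abs_of_nonneg (mul_nonneg hh0 hpp.le)])
  have hle : |f (x₀ + h * phi x₀) - 2 * f x₀ + f (x₀ - h * phi x₀)| ≤ omega2phi f h := by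
    apply le_csSup hbdd
    have hk2 : 0 < 1 + h ^ 2 := by positivity
    refine ⟨h, ⟨hh0, le_rfl⟩, x₀, ⟨?_, ?_⟩, rfl⟩
    · rw [div_le_iff₀ hk2]; nlinarith [sq_nonneg h]
    · rw [le_div_iff₀ hk2]; nlinarith [sq_nonneg h]
  refine le_trans ?_ (hk.trans hle)
  rw [← hsq]
  calc lam₀ * h ^ 2 * supNorm (fun x => phi x ^ 2 * F x)
      ≤ lam₀ * h ^ 2 * |phi x₀ ^ 2 * F x₀| := by gcongr
    _ = lam₀ * |F x₀| * (h * phi x₀) ^ 2 := by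
      rw [abs_mul, abs_of_nonneg (sq_nonneg (phi x₀))]; ring
end

section
/- For f(x) = eˣ on [0,1] and all natural numbers n > 1024·e², it holds that ‖B_n(exp) − exp‖ ≥ (1/64)·ω²_φ(exp, 1/√n). -/
open Real Set Filter

lemma bern_exp_half (n : ℕ) (hn : 0 < n) :
    bern n Real.exp (1 / 2) = Real.exp (1 / 2) * Real.cosh (1 / (2 * n)) ^ n := by
  have hn' : (n : ℝ) ≠ 0 := by positivity
  have h1 : bern n Real.exp (1 / 2) = (Real.exp (1 / n) * (1 / 2) + (1 - 1 / 2)) ^ n := by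
    rw [add_pow]
    unfold bern
    refine Finset.sum_congr rfl fun k _ => ?_
    rw [mul_pow, ← Real.exp_nat_mul, mul_one_div]
    ring
  have h2 : Real.exp (1 / n) * (1 / 2) + (1 - 1 / 2)
      = Real.exp (1 / (2 * n)) * Real.cosh (1 / (2 * n)) := by
    rw [Real.cosh_eq, ← mul_div_assoc (Real.exp (1 / (2 * (n : ℝ)))), mul_add, ← Real.exp_add, ← Real.exp_add,
      add_neg_cancel, Real.exp_zero]
    have : (1 / (2 * n) + 1 / (2 * n) : ℝ) = 1 / n := by field_simp; norm_num
    rw [this]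
    ring
  rw [h1, h2, mul_pow, ← Real.exp_nat_mul]
  congr 2
  field_simp

lemma one_add_sq_le_cosh (t : ℝ) : 1 + t ^ 2 / 2 ≤ Real.cosh t := by
  have h := Real.cosh_two_mul (t / 2)
  have h0 := Real.cosh_sq (t / 2)
  have h3 : (t / 2) ^ 2 ≤ Real.sinh (t / 2) ^ 2 := by
    rw [← sq_abs, ← sq_abs (Real.sinh (t / 2)), Real.abs_sinh]
    have := Real.self_le_sinh_iff.2 (abs_nonneg (t / 2))
    gcongr
  rw [show 2 * (t / 2) = t by ring] at h
  nlinarith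

lemma lower (n : ℕ) (hn : 0 < n) :
    1 / (8 * (n : ℝ)) ≤ bern n Real.exp (1 / 2) - Real.exp (1 / 2) := by
  have hn' : (0 : ℝ) < n := by exact_mod_cast hn
  rw [bern_exp_half n hn]
  have h1 := one_add_sq_le_cosh (1 / (2 * n))
  have h2 : 1 + (n : ℝ) * ((1 / (2 * n)) ^ 2 / 2) ≤ (1 + (1 / (2 * (n : ℝ))) ^ 2 / 2) ^ n :=
    one_add_mul_le_pow (by have : 0 ≤ (1 / (2 * (n : ℝ))) ^ 2 / 2 := by positivity
                           linarith) n
  have h3 : (1 + (1 / (2 * (n : ℝ))) ^ 2 / 2) ^ n ≤ Real.cosh (1 / (2 * n)) ^ n := by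
    gcongr
  have h4 : (n : ℝ) * ((1 / (2 * n)) ^ 2 / 2) = 1 / (8 * n) := by field_simp; norm_num
  have h5 : 1 ≤ Real.exp (1 / 2) := Real.one_le_exp (by norm_num)
  have h6 : 0 ≤ 1 / (8 * (n : ℝ)) := by positivity
  nlinarith

lemma upper (n : ℕ) (hn : 0 < n) :
    omega2phi Real.exp (1 / Real.sqrt n) ≤ 3 / (2 * n) := by
  have hn' : (0 : ℝ) < n := by exact_mod_cast hn
  have hn1 : (1 : ℝ) ≤ n := by exact_mod_cast hn
  apply Real.sSup_le _ (by positivity)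
  rintro y ⟨h, ⟨h0, hd⟩, x, ⟨hx0, hx1⟩, rfl⟩
  have hx : x ≤ 1 := hx1.trans (by rw [div_le_one (by positivity)]; nlinarith)
  have hx0' : 0 ≤ x := le_trans (by positivity) hx0
  set t := h * phi x with ht
  have e : Real.exp (x + t) - 2 * Real.exp x + Real.exp (x - t)
      = Real.exp x * (2 * (Real.cosh t - 1)) := by
    rw [Real.cosh_eq, sub_eq_add_neg x t, Real.exp_add, Real.exp_add]; ring
  have hc := Real.one_le_cosh t
  have ht2 : t ^ 2 ≤ 1 / (4 * n) := by
    have hp : phi x ^ 2 ≤ 1 / 4 := by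
      unfold phi
      rw [Real.sq_sqrt (mul_nonneg hx0' (by linarith))]
      nlinarith [sq_nonneg (x - 1 / 2)]
    have hh : h ^ 2 ≤ 1 / n := by
      calc h ^ 2 ≤ (1 / Real.sqrt n) ^ 2 := by gcongr
        _ = 1 / (n : ℝ) := by rw [div_pow, Real.sq_sqrt hn'.le, one_pow]
    calc t ^ 2 = h ^ 2 * phi x ^ 2 := by rw [ht]; ring
      _ ≤ 1 / (n : ℝ) * (1 / 4) := by gcongr
      _ = 1 / (4 * (n : ℝ)) := by field_simp
  have hq : 1 / (4 * (n : ℝ)) ≤ 1 := by rw [div_le_one (by positivity)]; linarith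
  have h7 : |t ^ 2 / 2| = t ^ 2 / 2 := abs_of_nonneg (by positivity)
  have h8 := Real.abs_exp_sub_one_le (x := t ^ 2 / 2) (by rw [h7]; nlinarith [sq_nonneg t])
  rw [h7] at h8
  have h9 := (le_abs_self _).trans h8
  have h10 := Real.cosh_le_exp_half_sq t
  have hE : Real.exp x ≤ 3 := by
    have := Real.exp_le_exp.2 hx
    have := Real.exp_one_lt_d9
    linarith
  rw [e, abs_of_nonneg (mul_nonneg (Real.exp_pos x).le (by linarith))]
  calc Real.exp x * (2 * (Real.cosh t - 1)) ≤ 3 * (2 * (1 / (4 * (n : ℝ)))) := by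
        gcongr
        linarith
    _ = 3 / (2 * (n : ℝ)) := by field_simp; norm_num

/-- **Example 1.** For `f = exp` and all `n > 1024·e²`,
`‖B_n(exp) - exp‖ ≥ (1/64)·ω²_φ(exp,1/√n)`. -/
theorem example_exp :
    ∀ n : ℕ, 1024 * Real.exp 1 ^ 2 < (n : ℝ) →
      1 / 64 * omega2phi Real.exp (1 / Real.sqrt n) ≤
        supNorm (fun x => bern n Real.exp x - Real.exp x) := by
  intro n hn
  have hn' : (0 : ℝ) < n := lt_of_le_of_lt (by positivity) hn
  have hn0 : 0 < n := by exact_mod_cast hn'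
  have h1 := lower n hn0
  have h2 := upper n hn0
  have h3 : |bern n Real.exp (1 / 2) - Real.exp (1 / 2)| ≤
      supNorm (fun x => bern n Real.exp x - Real.exp x) := by
    apply le_csSup
    · apply IsCompact.bddAbove_image isCompact_Icc
      unfold bern
      fun_prop
    · exact ⟨1 / 2, by constructor <;> norm_num, rfl⟩
  have h4 := le_abs_self (bern n Real.exp (1 / 2) - Real.exp (1 / 2))
  have h5 : 1 / 64 * (3 / (2 * (n : ℝ))) ≤ 1 / (8 * n) := by
    have : 0 < 1 / (n : ℝ) := by positivity
    have a : 1 / 64 * (3 / (2 * (n : ℝ))) = 3 / 128 * (1 / n) := by field_simp; norm_num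
    have b : 1 / (8 * (n : ℝ)) = 1 / 8 * (1 / n) := by field_simp
    rw [a, b]
    linarith
  linarith
end

section
/- For f(x) = cos(x) on [0,1] and all natural numbers n ≥ ⌊1024/cos(1)⌋ + 1, it holds that ‖B_n(cos) − cos‖ ≥ (1/64)·ω²_φ(cos, 1/√n). -/
open Real Set Filter

lemma bern_cos_half (n : ℕ) (hn : 0 < n) :
    bern n Real.cos (1 / 2) = Real.cos (1 / (2 * n)) ^ n * Real.cos (1 / 2) := by
  have hn' : (n : ℝ) ≠ 0 := by positivity
  have hnC : (n : ℂ) ≠ 0 := by exact_mod_cast hn.ne'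
  set y : ℝ := 1 / (2 * n) with hy
  have key : ((Complex.exp (2 * y * Complex.I) + 1) / 2) ^ n
      = (Complex.cos y) ^ n * Complex.exp ((1 / 2 : ℝ) * Complex.I) := by
    have h1 : (Complex.exp (2 * y * Complex.I) + 1) / 2
        = Complex.cos y * Complex.exp (y * Complex.I) := by
      have e1 : Complex.exp (2 * y * Complex.I)
          = Complex.exp (y * Complex.I) * Complex.exp (y * Complex.I) := by
        rw [← Complex.exp_add]; congr 1; ring
      have e2 : Complex.exp (-y * Complex.I) * Complex.exp (y * Complex.I) = 1 := by
        rw [← Complex.exp_add]; simp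
      rw [Complex.cos, e1]
      linear_combination (-1 / 2 : ℂ) * e2
    rw [h1, mul_pow, ← Complex.exp_nat_mul]
    congr 2
    rw [hy]; push_cast; field_simp
  have hsum : ((Complex.exp (2 * y * Complex.I) + 1) / 2) ^ n
      = ∑ k ∈ Finset.range (n + 1), ((((n.choose k : ℝ) * (1 / 2) ^ n : ℝ) : ℂ) *
          Complex.exp (((k : ℝ) / n : ℝ) * Complex.I)) := by
    rw [div_pow, add_pow, Finset.sum_div]
    refine Finset.sum_congr rfl fun k _ => ?_
    rw [← Complex.exp_nat_mul]
    have : (k : ℂ) * (2 * y * Complex.I) = ((k : ℝ) / n : ℝ) * Complex.I := by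
      rw [hy]; push_cast; field_simp
    rw [this]; push_cast
    simp only [one_pow, one_div, inv_pow]; ring
  have hre := congrArg Complex.re (hsum.symm.trans key)
  rw [← Complex.ofReal_cos, ← Complex.ofReal_pow, Complex.re_ofReal_mul,
    Complex.exp_ofReal_mul_I_re, Complex.re_sum] at hre
  rw [← hre, bern]
  refine Finset.sum_congr rfl fun k hk => ?_
  rw [Complex.re_ofReal_mul, Complex.exp_ofReal_mul_I_re]
  have hk' : k ≤ n := by simpa [Nat.lt_succ_iff] using hk
  have : ((1 / 2 : ℝ)) ^ n = (1 / 2) ^ k * (1 - 1 / 2) ^ (n - k) := by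
    norm_num only
    rw [← pow_add, Nat.add_sub_cancel' hk']
  rw [this]; ring

lemma pow_cos_le (n : ℕ) (hn : 0 < n) :
    Real.cos (1 / (2 * n)) ^ n ≤ 1 - 1 / (21 * n) := by
  have hn1 : (1 : ℝ) ≤ n := by exact_mod_cast hn
  have hy1 : 1 / (2 * (n : ℝ)) ≤ 1 := by
    rw [div_le_one (by positivity)]; linarith
  have hy0 : 0 ≤ 1 / (2 * (n : ℝ)) := by positivity
  have hpi : π ^ 2 ≤ 10 := by nlinarith [Real.pi_lt_d2, Real.pi_pos]
  have hq := Real.cos_le_one_sub_mul_cos_sq (x := 1 / (2 * (n : ℝ)))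
    (by rw [abs_of_nonneg hy0]; linarith [Real.pi_gt_three])
  have hc0 : 0 ≤ Real.cos (1 / (2 * (n : ℝ))) :=
    Real.cos_nonneg_of_neg_pi_div_two_le_of_le (by linarith [Real.pi_pos])
      (by linarith [Real.pi_gt_three])
  set u : ℝ := 1 / (20 * n ^ 2) with hu
  have hu0 : 0 < u := by positivity
  have h1 : u ≤ 2 / π ^ 2 * (1 / (2 * (n : ℝ))) ^ 2 := by
    have : (1 : ℝ) / 5 ≤ 2 / π ^ 2 := by
      rw [div_le_div_iff₀ (by norm_num) (by positivity)]; linarith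
    calc u = 1 / 5 * (1 / (2 * (n : ℝ))) ^ 2 := by rw [hu]; field_simp; norm_num
      _ ≤ _ := by gcongr
  have h2 : Real.cos (1 / (2 * (n : ℝ))) ≤ (1 + u)⁻¹ := by
    rw [← one_div, le_div_iff₀ (by positivity)]
    nlinarith
  have h3 : Real.cos (1 / (2 * (n : ℝ))) ^ n ≤ ((1 + u) ^ n)⁻¹ := by
    rw [← inv_pow]; exact pow_le_pow_left₀ hc0 h2 n
  have h4 : 1 + n * u ≤ (1 + u) ^ n := one_add_mul_le_pow (by linarith) n
  have h5 : n * u = 1 / (20 * n) := by rw [hu]; field_simp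
  rw [h5] at h4
  refine h3.trans ((inv_anti₀ (by positivity) h4).trans ?_)
  have h6 : (1 + 1 / (20 * (n : ℝ)))⁻¹ = 20 * n / (20 * n + 1) := by field_simp
  have h7 : 1 - 1 / (21 * (n : ℝ)) = (21 * n - 1) / (21 * n) := by field_simp
  rw [h6, h7, div_le_div_iff₀ (by positivity) (by positivity)]
  nlinarith

lemma omega_le_s9 (n : ℕ) (hn : 0 < n) :
    omega2phi Real.cos (1 / Real.sqrt n) ≤ 1 / (4 * n) := by
  have hn1 : (0 : ℝ) < n := by exact_mod_cast hn
  apply Real.sSup_le _ (by positivity)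
  rintro y ⟨h, ⟨h0, hd⟩, x, ⟨hx0, hx1⟩, rfl⟩
  have hx0' : 0 ≤ x := le_trans (by positivity) hx0
  have hx1' : x ≤ 1 := hx1.trans (by rw [div_le_one (by positivity)]; nlinarith)
  have hph : (phi x) ^ 2 ≤ 1 / 4 := by
    rw [phi, Real.sq_sqrt (mul_nonneg hx0' (by linarith))]
    nlinarith [sq_nonneg (x - 1 / 2)]
  have hh : h ^ 2 ≤ 1 / n := by
    calc h ^ 2 ≤ (1 / Real.sqrt n) ^ 2 := by gcongr
      _ = 1 / (n : ℝ) := by rw [div_pow, Real.sq_sqrt hn1.le, one_pow]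
  set t := h * phi x with ht
  have ht2 : t ^ 2 ≤ 1 / (4 * n) := by
    calc t ^ 2 = h ^ 2 * phi x ^ 2 := by rw [ht]; ring
      _ ≤ 1 / (n : ℝ) * (1 / 4) := by gcongr
      _ = _ := by field_simp
  have e : Real.cos (x + t) - 2 * Real.cos x + Real.cos (x - t)
      = -(2 * Real.cos x * (1 - Real.cos t)) := by
    rw [Real.cos_add, Real.cos_sub]; ring
  have h1 := Real.one_sub_sq_div_two_le_cos (x := t)
  have h2 := Real.cos_le_one t
  rw [e, abs_neg, abs_mul, abs_mul, abs_of_nonneg (sub_nonneg.2 h2), abs_two]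
  nlinarith [Real.abs_cos_le_one x, abs_nonneg (Real.cos x)]

/-- **Example 2.** For `f = cos` and all `n ≥ ⌊1024/cos 1⌋ + 1`,
`‖B_n(cos) - cos‖ ≥ (1/64)·ω²_φ(cos,1/√n)`. -/
theorem example_cos :
    ∀ n : ℕ, Nat.floor (1024 / Real.cos 1) + 1 ≤ n →
      1 / 64 * omega2phi Real.cos (1 / Real.sqrt n) ≤
        supNorm (fun x => bern n Real.cos x - Real.cos x) := by
  intro n hn
  have hn0 : 0 < n := by omega
  have hn1 : (0 : ℝ) < n := by exact_mod_cast hn0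
  have hb : BddAbove ((fun x => |(fun x => bern n Real.cos x - Real.cos x) x|) ''
      Set.Icc (0 : ℝ) 1) := by
    apply IsCompact.bddAbove_image isCompact_Icc
    unfold bern
    fun_prop
  have hle : |bern n Real.cos (1 / 2) - Real.cos (1 / 2)| ≤
      supNorm (fun x => bern n Real.cos x - Real.cos x) :=
    le_csSup hb ⟨1 / 2, by norm_num, rfl⟩
  have h1 := omega_le_s9 n hn0
  have h2 := pow_cos_le n hn0
  have h3 := Real.one_sub_sq_div_two_le_cos (x := 1 / 2)
  have h4 := neg_abs_le (bern n Real.cos (1 / 2) - Real.cos (1 / 2))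
  rw [bern_cos_half n hn0] at h4 hle
  have e1 : 1 / (4 * (n : ℝ)) = 1 / 4 * (1 / n) := by field_simp
  have e2 : 1 / (21 * (n : ℝ)) = 1 / 21 * (1 / n) := by field_simp
  have h5 : 0 < 1 / (n : ℝ) := by positivity
  rw [e1] at h1
  rw [e2] at h2
  nlinarith
end

section
/- For every h with 0 ≤ h ≤ 1 and every x ∈ [h²/(1+h²), 1/(1+h²)], the function sin satisfies |sin(x + hφ(x)) − 2·sin(x) + sin(x − hφ(x))| = 4·sin(x)·sin²(hφ(x)/2) ≥ (8/π³)·x·h²·φ²(x). -/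
open Real Set Filter

/-- For `0 ≤ h ≤ 1` and `x ∈ [h²/(1+h²), 1/(1+h²)]`,
`|sin(x+hφ(x)) - 2 sin x + sin(x-hφ(x))| = 4 sin x · sin²(hφ(x)/2) ≥ (8/π³)·x·h²·φ²(x)`. -/
theorem sin_second_difference
    (h : ℝ) (hh : h ∈ Set.Icc (0 : ℝ) 1)
    (x : ℝ) (hx : x ∈ Set.Icc (h ^ 2 / (1 + h ^ 2)) (1 / (1 + h ^ 2))) :
    |Real.sin (x + h * phi x) - 2 * Real.sin x + Real.sin (x - h * phi x)| =
      4 * Real.sin x * Real.sin (h * phi x / 2) ^ 2 ∧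
    8 / Real.pi ^ 3 * x * h ^ 2 * phi x ^ 2 ≤
      4 * Real.sin x * Real.sin (h * phi x / 2) ^ 2 := by
  obtain ⟨h0, h1⟩ := hh
  obtain ⟨hx1, hx2⟩ := hx
  have hx0 : 0 ≤ x := le_trans (by positivity) hx1
  have hxle : x ≤ 1 := hx2.trans (by
    rw [div_le_one (by positivity)]
    nlinarith [sq_nonneg h])
  have hp0 : 0 ≤ phi x := Real.sqrt_nonneg _
  have hp1 : phi x ≤ 1 := by
    unfold phi
    rw [Real.sqrt_le_iff]
    refine ⟨by norm_num, ?_⟩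
    nlinarith
  have hpi := Real.pi_gt_three
  have ht0 : 0 ≤ h * phi x := mul_nonneg h0 hp0
  have ht1 : h * phi x ≤ 1 := mul_le_one₀ h1 hp0 hp1
  have hsx : 2 / Real.pi * x ≤ Real.sin x := Real.mul_le_sin hx0 (by linarith)
  have hst : 2 / Real.pi * (h * phi x / 2) ≤ Real.sin (h * phi x / 2) :=
    Real.mul_le_sin (by linarith) (by linarith)
  have hsx0 : 0 ≤ Real.sin x := le_trans (by positivity) hsx
  constructor
  · have key : Real.sin (x + h * phi x) - 2 * Real.sin x + Real.sin (x - h * phi x) =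
        -(4 * Real.sin x * Real.sin (h * phi x / 2) ^ 2) := by
      have hc : Real.cos (h * phi x) = 1 - 2 * Real.sin (h * phi x / 2) ^ 2 := by
        have := Real.cos_two_mul (h * phi x / 2)
        rw [Real.cos_sq'] at this
        rw [show h * phi x = 2 * (h * phi x / 2) by ring, this]
        ring_nf
      rw [Real.sin_add, Real.sin_sub, hc]
      ring
    rw [key, abs_neg, abs_of_nonneg (by positivity)]
  · have e : 8 / Real.pi ^ 3 * x * h ^ 2 * phi x ^ 2 =
        4 * (2 / Real.pi * x) * (2 / Real.pi * (h * phi x / 2)) ^ 2 := by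
      field_simp
      ring
    rw [e]
    gcongr
end

section
/- For every δ with 0 ≤ δ ≤ 1/√2, it holds that ω²_φ(sin, δ) ≥ (32/(27π³))·δ². In particular, for every natural number n ≥ 2, ω²_φ(sin, 1/√n) ≥ (32/(27π³))·(1/n) ≥ (32/(27π³))·(1/n)·‖φ²·sin″‖, i.e. the lower modulus estimate holds for sin with λ₀ = 32/(27π³) and n₀ = 2. -/
open Real Set Filter

/-- For `0 ≤ δ ≤ 1/√2`, `ω²_φ(sin,δ) ≥ (32/(27π³))δ²`; in particular for every `n ≥ 2`,
`ω²_φ(sin,1/√n) ≥ (32/(27π³))(1/n) ≥ (32/(27π³))(1/n)·‖φ²·sin''‖`. -/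
theorem sin_lower_modulus_estimate :
    (∀ δ : ℝ, 0 ≤ δ → δ ≤ 1 / Real.sqrt 2 →
      32 / (27 * Real.pi ^ 3) * δ ^ 2 ≤ omega2phi Real.sin δ) ∧
    (∀ n : ℕ, 2 ≤ n →
      32 / (27 * Real.pi ^ 3) * (1 / n) ≤ omega2phi Real.sin (1 / Real.sqrt n) ∧
      32 / (27 * Real.pi ^ 3) * (1 / n) * supNorm (fun x => phi x ^ 2 * (-Real.sin x)) ≤
        32 / (27 * Real.pi ^ 3) * (1 / n)) := by
  have main : ∀ δ : ℝ, 0 ≤ δ → δ ≤ 1 / Real.sqrt 2 →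
      32 / (27 * Real.pi ^ 3) * δ ^ 2 ≤ omega2phi Real.sin δ := by
    intro δ h0 h1
    have hsq : δ ^ 2 ≤ 1 / 2 := by
      calc δ ^ 2 ≤ (1 / Real.sqrt 2) ^ 2 := by gcongr
        _ = 1 / 2 := by rw [div_pow, Real.sq_sqrt (by norm_num)]; norm_num
    have hpos : (0 : ℝ) < 1 + δ ^ 2 := by positivity
    have hs2 : phi (2 / 3) ^ 2 = 2 / 9 := by
      unfold phi
      rw [Real.sq_sqrt (by norm_num)]
      norm_num
    have hs0 : 0 ≤ phi (2 / 3) := Real.sqrt_nonneg _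
    have hbdd : BddAbove {y : ℝ | ∃ h ∈ Set.Icc (0 : ℝ) δ,
        ∃ x ∈ Set.Icc (h ^ 2 / (1 + h ^ 2)) (1 / (1 + h ^ 2)),
        y = |Real.sin (x + h * phi x) - 2 * Real.sin x + Real.sin (x - h * phi x)|} := by
      refine ⟨4, ?_⟩
      rintro y ⟨h, -, x, -, rfl⟩
      have a1 := Real.neg_one_le_sin (x + h * phi x)
      have a2 := Real.sin_le_one (x + h * phi x)
      have b1 := Real.neg_one_le_sin x
      have b2 := Real.sin_le_one x
      have c1 := Real.neg_one_le_sin (x - h * phi x)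
      have c2 := Real.sin_le_one (x - h * phi x)
      rw [abs_le]
      constructor <;> linarith
    have hmem : |Real.sin (2 / 3 + δ * phi (2 / 3)) - 2 * Real.sin (2 / 3)
        + Real.sin (2 / 3 - δ * phi (2 / 3))| ≤ omega2phi Real.sin δ := by
      refine le_csSup hbdd ⟨δ, ⟨h0, le_refl _⟩, 2 / 3, ⟨?_, ?_⟩, rfl⟩
      · rw [div_le_iff₀ hpos]; linarith
      · rw [le_div_iff₀ hpos]; linarith
    refine le_trans ?_ hmem
    set s := phi (2 / 3)
    set t := δ * s / 2 with ht
    have ht0 : 0 ≤ t := by positivity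
    have ht1 : t ≤ Real.pi / 2 := by
      have hp := Real.pi_gt_three
      have : δ ≤ 1 := by nlinarith
      have : s ≤ 1 := by nlinarith
      have : δ * s ≤ 1 := by nlinarith
      linarith
    have e : Real.sin (2 / 3 + δ * s) - 2 * Real.sin (2 / 3) + Real.sin (2 / 3 - δ * s)
        = -(4 * Real.sin (2 / 3) * Real.sin t ^ 2) := by
      have h2 : δ * s = 2 * t := by rw [ht]; ring
      rw [h2, Real.sin_add, Real.sin_sub, Real.cos_two_mul, Real.cos_sq']
      ring
    have k1 : 2 / Real.pi * (2 / 3) ≤ Real.sin (2 / 3) :=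
      Real.mul_le_sin (by norm_num) (by linarith [Real.pi_gt_three])
    have k2 : 2 / Real.pi * t ≤ Real.sin t := Real.mul_le_sin ht0 ht1
    rw [e, abs_neg]
    refine le_trans ?_ (le_abs_self _)
    have hpi := Real.pi_pos
    have k10 : 0 ≤ 2 / Real.pi * (2 / 3) := by positivity
    have k20 : 0 ≤ 2 / Real.pi * t := by positivity
    calc 32 / (27 * Real.pi ^ 3) * δ ^ 2
        = 4 * (2 / Real.pi * (2 / 3)) * (2 / Real.pi * t) ^ 2 := by
          have : t ^ 2 = δ ^ 2 / 18 := by rw [ht, div_pow, mul_pow, hs2]; ring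
          rw [mul_pow, this]
          field_simp
          ring
      _ ≤ 4 * Real.sin (2 / 3) * Real.sin t ^ 2 := by
          have k11 : 0 ≤ Real.sin (2 / 3) := k10.trans k1
          gcongr
  refine ⟨main, fun n hn => ?_⟩
  have hn' : (2 : ℝ) ≤ n := by exact_mod_cast hn
  constructor
  · have := main (1 / Real.sqrt n) (by positivity) (by gcongr)
    rwa [div_pow, Real.sq_sqrt (by positivity), one_pow] at this
  · have hsup : supNorm (fun x => phi x ^ 2 * (-Real.sin x)) ≤ 1 := by
      unfold supNorm
      apply Real.sSup_le _ zero_le_one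
      rintro y ⟨x, ⟨hx0, hx1⟩, rfl⟩
      have hp : phi x ^ 2 = x * (1 - x) := by
        unfold phi
        exact Real.sq_sqrt (mul_nonneg hx0 (by linarith))
      show |phi x ^ 2 * (-Real.sin x)| ≤ 1
      rw [abs_mul, abs_neg, abs_of_nonneg (sq_nonneg _), hp]
      have := Real.abs_sin_le_one x
      have h3 : x * (1 - x) ≤ 1 := by nlinarith
      exact mul_le_one₀ h3 (abs_nonneg _) this
    have hc : 0 ≤ 32 / (27 * Real.pi ^ 3) * (1 / (n : ℝ)) := by
      have := Real.pi_pos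
      positivity
    exact mul_le_of_le_one_right hc hsup
end
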